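/- Let n ≥ 3, let F be the free group on x_1, …, x_n, let w ∈ F be nontrivial, not primitive and not a proper power, and set G = F/⟨⟨w⟩⟩. Suppose that G is residually finite and that every finite-index subgroup of G is a one-relator group. Let p be a prime and let U_1 ≤ U_2 ≤ G be subgroups of finite index in G such that p divides the index [U_2 : U_1]. Then the restriction map H^2(U_2; F_p) → H^2(U_1; F_p), induced in group cohomology by the inclusion U_1 ↪ U_2, is the zero map. -/

import Mathlib

open groupCohomology

/-- A group is a one-relator group if it admits a presentation with finitely many generators
and a single relator. -/
def IsOneRelatorGroup (G : Type*) [Group G] : Prop :=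
  ∃ (m : ℕ) (r : FreeGroup (Fin m)),
    Nonempty (G ≃* PresentedGroup ({r} : Set (FreeGroup (Fin m))))

/-- A group is residually finite if every nontrivial element avoids some finite-index normal
subgroup (equivalently, has nontrivial image in some finite quotient). -/
def ResiduallyFinite (G : Type*) [Group G] : Prop :=
  ∀ g : G, g ≠ 1 → ∃ N : Subgroup G, N.Normal ∧ N.FiniteIndex ∧ g ∉ N

section Restriction

variable (p : ℕ) {H G : Type} [Group H] [Group G]

/-- Pre-composition with a group homomorphism, on inhomogeneous cochains with trivial
`𝔽_p`-coefficients. -/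
@[simps]
def resCochain (φ : H →* G) (i : ℕ) :
    ((Fin i → G) → Rep.trivial (ZMod p) G (ZMod p)) →ₗ[ZMod p]
      ((Fin i → H) → Rep.trivial (ZMod p) H (ZMod p)) where
  toFun f g := f fun t => φ (g t)
  map_add' _ _ := rfl
  map_smul' _ _ := rfl

lemma contractNth_comp (φ : H →* G) {m : ℕ} (j : Fin (m + 1)) (g : Fin (m + 1) → H) :
    (fun t => φ (Fin.contractNth j (· * ·) g t)) =
      Fin.contractNth j (· * ·) (fun t => φ (g t)) := by
  funext t
  unfold Fin.contractNth
  split_ifs <;> simp [map_mul]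

/-- The restriction map along a group homomorphism, at the level of the complexes of
inhomogeneous cochains with trivial `𝔽_p`-coefficients. -/
noncomputable def resChainMap (φ : H →* G) :
    inhomogeneousCochains (Rep.trivial (ZMod p) G (ZMod p)) ⟶
      inhomogeneousCochains (Rep.trivial (ZMod p) H (ZMod p)) where
  f i := ModuleCat.ofHom (resCochain p φ i)
  comm' i j hij := by
    obtain rfl : i + 1 = j := hij
    rw [inhomogeneousCochains.d_def, inhomogeneousCochains.d_def]
    refine ModuleCat.hom_ext (LinearMap.ext fun f => funext fun g => ?_)
    show (inhomogeneousCochains.d (Rep.trivial (ZMod p) H (ZMod p)) i).hom (resCochain p φ i f) g =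
      resCochain p φ (i + 1) ((inhomogeneousCochains.d (Rep.trivial (ZMod p) G (ZMod p)) i).hom f) g
    simp only [inhomogeneousCochains.d_hom_apply, resCochain_apply, Rep.trivial_ρ_apply]
    congr 1
    refine Finset.sum_congr rfl fun j _ => ?_
    rw [contractNth_comp]

/-- The restriction map in group cohomology (with trivial `𝔽_p`-coefficients) along a group
homomorphism, obtained from `resChainMap` by passing to cohomology in degree `i`. -/
noncomputable def cohomologyRestriction (φ : H →* G) (i : ℕ) :
    groupCohomology (Rep.trivial (ZMod p) G (ZMod p)) i ⟶
      groupCohomology (Rep.trivial (ZMod p) H (ZMod p)) i :=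
  HomologicalComplex.homologyMap (resChainMap p φ) i

end Restriction

/-- A crossed homomorphism on a free group, relative to a permutation action and with values in
an arbitrary group, can be prescribed on the generators. -/
theorem exists_crossed {ι X E : Type*} [Group E] (a : FreeGroup ι →* Equiv.Perm X)
    (u : ι → X → E) :
    ∃ δ : FreeGroup ι → X → E, (∀ g h x, δ (g * h) x = δ g (a h x) * δ h x) ∧
      ∀ i x, δ (FreeGroup.of i) x = u i x := by
  let P : FreeGroup ι →* Equiv.Perm (X × E) := FreeGroup.lift fun i =>
    { toFun := fun y => (a (FreeGroup.of i) y.1, u i y.1 * y.2)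
      invFun := fun y => ((a (FreeGroup.of i))⁻¹ y.1, (u i ((a (FreeGroup.of i))⁻¹ y.1))⁻¹ * y.2)
      left_inv := fun y => by simp
      right_inv := fun y => by simp }
  have hof : ∀ i y, P (FreeGroup.of i) y = (a (FreeGroup.of i) y.1, u i y.1 * y.2) := by
    intro i y; simp [P]
  have key : ∀ g x c, P g (x, c) = (a g x, (P g (x, 1)).2 * c) := by
    intro g
    induction g using FreeGroup.induction_on with
    | C1 => intro x c; simp
    | of i => intro x c; simp [hof]
    | inv_of i ih =>
      intro x c
      have h : ∀ x c, (P (FreeGroup.of i))⁻¹ (x, c) = ((a (FreeGroup.of i))⁻¹ x,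
          (u i ((a (FreeGroup.of i))⁻¹ x))⁻¹ * c) := by
        intro x c
        rw [Equiv.Perm.inv_eq_iff_eq, hof]
        simp
      rw [map_inv, map_inv, h, h]
      simp
    | mul g h hg hh =>
      intro x c
      rw [map_mul, map_mul, Equiv.Perm.mul_apply, Equiv.Perm.mul_apply, Equiv.Perm.mul_apply,
        hh x c, hg, hh x 1, hg (a h x) ((P h (x, 1)).2 * 1)]
      simp [mul_assoc]
  refine ⟨fun g x => (P g (x, 1)).2, fun g h x => ?_, fun i x => by simp [hof]⟩
  show (P (g * h) (x, 1)).2 = (P g (a h x, 1)).2 * (P h (x, 1)).2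
  rw [map_mul, Equiv.Perm.mul_apply, key h, key g]

/-- Basic identities for crossed homomorphisms. -/
theorem crossed_one {G X E : Type*} [Group G] [Group E] {a : G →* Equiv.Perm X}
    {δ : G → X → E} (h : ∀ g h x, δ (g * h) x = δ g (a h x) * δ h x) (x : X) : δ 1 x = 1 := by
  simpa using h 1 1 x

theorem crossed_inv {G X E : Type*} [Group G] [Group E] {a : G →* Equiv.Perm X}
    {δ : G → X → E} (h : ∀ g h x, δ (g * h) x = δ g (a h x) * δ h x) (g : G) (x : X) :
    δ g⁻¹ x = (δ g (a g⁻¹ x))⁻¹ := by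
  have := h g g⁻¹ x
  rw [mul_inv_cancel, crossed_one h] at this
  exact (inv_eq_of_mul_eq_one_right this.symm).symm

/-- A crossed homomorphism conjugates on elements acting trivially. -/
theorem crossed_conj {G X E : Type*} [Group G] [Group E] {a : G →* Equiv.Perm X}
    {δ : G → X → E} (h : ∀ g h x, δ (g * h) x = δ g (a h x) * δ h x) (g r : G) (hr : a r = 1)
    (x : X) :
    δ (g * r * g⁻¹) x = δ g (a g⁻¹ x) * δ r (a g⁻¹ x) * (δ g (a g⁻¹ x))⁻¹ := by
  rw [h, h, crossed_inv h, hr]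
  simp

/-- Two crossed homomorphisms on a free group, along an equivariant map of sets and a
homomorphism of coefficients, agree if they agree on generators. -/
theorem crossed_unique {ι X Y E E' : Type*} [Group E] [Group E'] {a : FreeGroup ι →* Equiv.Perm X}
    {b : FreeGroup ι →* Equiv.Perm Y} (q : X → Y) (hq : ∀ g x, q (a g x) = b g (q x))
    (κ : E →* E')
    {δ : FreeGroup ι → X → E} (h : ∀ g h x, δ (g * h) x = δ g (a h x) * δ h x)
    {ε : FreeGroup ι → Y → E'} (h' : ∀ g h x, ε (g * h) x = ε g (b h x) * ε h x)
    (hof : ∀ i x, κ (δ (FreeGroup.of i) x) = ε (FreeGroup.of i) (q x)) (g : FreeGroup ι) (x : X) :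
    κ (δ g x) = ε g (q x) := by
  induction g using FreeGroup.induction_on generalizing x with
  | C1 => rw [crossed_one h, crossed_one h', map_one]
  | of i => exact hof i x
  | inv_of i ih => rw [crossed_inv h, crossed_inv h', map_inv, ih, hq]
  | mul g k hg hk => rw [h, h', map_mul, hg, hk, hq]

/-- Additive cocycles of a group acting on `X` with values in a field `K`; these are the
derivations into the permutation module `X → K`. -/
def actionCocycles (K : Type*) [Field K] {G X : Type*} [Group G] (a : G →* Equiv.Perm X) :
    Submodule K (G → X → K) where
  carrier := {δ | ∀ g h x, δ (g * h) x = δ g (a h x) + δ h x}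
  add_mem' := by
    intro δ ε hδ hε g h x
    simp only [Pi.add_apply, hδ g h x, hε g h x]
    ring
  zero_mem' := by intro g h x; simp
  smul_mem' := by
    intro c δ hδ g h x
    simp only [Pi.smul_apply, hδ g h x, smul_eq_mul]
    ring

section Cocycles

variable {K : Type*} [Field K] {G X : Type*} [Group G] {a : G →* Equiv.Perm X}

theorem actionCocycles_one {δ : G → X → K} (h : δ ∈ actionCocycles K a) (x : X) : δ 1 x = 0 := by
  simpa using h 1 1 x

theorem actionCocycles_inv {δ : G → X → K} (h : δ ∈ actionCocycles K a) (g : G) (x : X) :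
    δ g⁻¹ x = -δ g (a g⁻¹ x) := by
  have := h g g⁻¹ x
  rw [mul_inv_cancel, actionCocycles_one h] at this
  linear_combination -this

theorem actionCocycles_conj {δ : G → X → K} (h : δ ∈ actionCocycles K a) (g r : G)
    (hr : a r = 1) (x : X) : δ (g * r * g⁻¹) x = δ r (a g⁻¹ x) := by
  rw [h, h, actionCocycles_inv h, hr]
  simp

/-- Restriction of cocycles on a free group to the generators. -/
noncomputable def freeCocyclesEquiv {ι : Type*} (a : FreeGroup ι →* Equiv.Perm X) :
    actionCocycles K a ≃ₗ[K] (ι → X → K) :=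
  LinearEquiv.ofBijective
    { toFun := fun δ i x => δ.1 (FreeGroup.of i) x
      map_add' := fun _ _ => rfl
      map_smul' := fun _ _ => rfl } <| by
    constructor
    · intro δ ε h
      apply Subtype.ext
      funext g x
      have hof : ∀ i x, δ.1 (FreeGroup.of i) x = ε.1 (FreeGroup.of i) x :=
        fun i x => congrFun (congrFun h i) x
      induction g using FreeGroup.induction_on generalizing x with
      | C1 => rw [actionCocycles_one δ.2, actionCocycles_one ε.2]
      | of i => exact hof i x
      | inv_of i ih => rw [actionCocycles_inv δ.2, actionCocycles_inv ε.2, ih]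
      | mul g k hg hk => rw [δ.2, ε.2, hg, hk]
    · intro u
      obtain ⟨δ, h1, h2⟩ := exists_crossed a (fun i x => Multiplicative.ofAdd (u i x))
      refine ⟨⟨fun g x => (δ g x).toAdd, fun g h x => ?_⟩, ?_⟩
      · simp [h1]
      · funext i x
        simp [h2]

theorem finrank_freeCocycles [Fintype X] (m : ℕ) (a : FreeGroup (Fin m) →* Equiv.Perm X) :
    FiniteDimensional K (actionCocycles K a) ∧
      Module.finrank K (actionCocycles K a) = m * Fintype.card X := by
  refine ⟨LinearEquiv.finiteDimensional (freeCocyclesEquiv (K := K) a).symm, ?_⟩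
  rw [LinearEquiv.finrank_eq (freeCocyclesEquiv (K := K) a)]
  simp [Module.finrank_pi_fintype]

/-- Evaluation of cocycles on the stabiliser of a point. -/
def shapiroMap (H : Subgroup G) (x₀ : X) (hH : ∀ g, g ∈ H ↔ a g x₀ = x₀) :
    actionCocycles K a →ₗ[K] (Additive H →+ K) where
  toFun δ :=
    { toFun := fun h => δ.1 h.toMul.1 x₀
      map_zero' := actionCocycles_one δ.2 x₀
      map_add' := fun g h => by
        have := δ.2 g.toMul.1 h.toMul.1 x₀
        rw [(hH _).1 h.toMul.2] at this
        exact this }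
  map_add' _ _ := rfl
  map_smul' _ _ := rfl

theorem shapiroMap_surjective (H : Subgroup G) (x₀ : X) (hH : ∀ g, g ∈ H ↔ a g x₀ = x₀)
    (htr : ∀ x, ∃ g, a g x₀ = x) :
    Function.Surjective (shapiroMap (K := K) H x₀ hH) := by
  classical
  intro φ
  obtain ⟨s, hs, hs1⟩ : ∃ s : X → G, (∀ x, a (s x) x₀ = x) ∧ s x₀ = 1 := by
    choose s hs using htr
    refine ⟨Function.update s x₀ 1, fun x => ?_, by simp⟩
    by_cases hx : x = x₀
    · subst hx; simp
    · simp [hx, hs]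
  have hmem : ∀ g x, (s (a g x))⁻¹ * g * s x ∈ H := by
    intro g x
    rw [hH, map_mul, map_mul, Equiv.Perm.mul_apply, Equiv.Perm.mul_apply, hs, map_inv,
      Equiv.Perm.inv_eq_iff_eq, hs]
  refine ⟨⟨fun g x => φ (Additive.ofMul ⟨_, hmem g x⟩), fun g h x => ?_⟩, ?_⟩
  · show φ _ = φ _ + φ _
    rw [← map_add, ← ofMul_mul]
    congr 2
    apply Subtype.ext
    simp [mul_assoc]
  · ext h
    have h1 : a h.1 x₀ = x₀ := (hH _).1 h.2
    show φ _ = φ (Additive.ofMul h)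
    congr 2
    apply Subtype.ext
    simp [h1, hs1]

theorem finrank_actionCocycles [Fintype X] (H : Subgroup G) (x₀ : X)
    (hH : ∀ g, g ∈ H ↔ a g x₀ = x₀) (htr : ∀ x, ∃ g, a g x₀ = x)
    (hfin : FiniteDimensional K (actionCocycles K a)) :
    FiniteDimensional K (Additive H →+ K) ∧
    Module.finrank K (actionCocycles K a) + 1 =
      Module.finrank K (Additive H →+ K) + Fintype.card X := by
  have hsurj := shapiroMap_surjective (K := K) H x₀ hH htr
  refine ⟨Module.Finite.of_surjective _ hsurj, ?_⟩
  let B : (X → K) →ₗ[K] actionCocycles K a :=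
    { toFun := fun f => ⟨fun g x => f (a g x) - f x, fun g h x => by simp⟩
      map_add' := fun f f' => by
        apply Subtype.ext; funext g x
        show (f + f') _ - (f + f') _ = (f _ - f _) + (f' _ - f' _)
        simp only [Pi.add_apply]; ring
      map_smul' := fun c f => by
        apply Subtype.ext; funext g x
        show (c • f) _ - (c • f) _ = c * (f _ - f _)
        simp only [Pi.smul_apply, smul_eq_mul]; ring }
  have hker : LinearMap.ker B = Submodule.span K {fun _ => (1 : K)} := by
    apply le_antisymm
    · intro f hf
      rw [Submodule.mem_span_singleton]
      refine ⟨f x₀, ?_⟩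
      funext x
      obtain ⟨g, hg⟩ := htr x
      have : f (a g x₀) - f x₀ = 0 := congrFun (congrFun (congrArg Subtype.val hf) g) x₀
      rw [hg] at this
      simp only [Pi.smul_apply, smul_eq_mul, mul_one]
      linear_combination -this
    · rw [Submodule.span_singleton_le_iff_mem]
      apply Subtype.ext
      funext g x
      exact sub_self _
  have hrange : LinearMap.range B = LinearMap.ker (shapiroMap (K := K) H x₀ hH) := by
    apply le_antisymm
    · rintro _ ⟨f, rfl⟩
      ext h
      show f (a h.1 x₀) - f x₀ = 0
      rw [(hH _).1 h.2, sub_self]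
    · intro δ hδ
      have h0 : ∀ h ∈ H, δ.1 h x₀ = 0 := fun h hh =>
        DFunLike.congr_fun (LinearMap.mem_ker.1 hδ) (Additive.ofMul (⟨h, hh⟩ : H))
      choose s hs using htr
      have hwd : ∀ g, δ.1 (s (a g x₀)) x₀ = δ.1 g x₀ := by
        intro g
        have hm : g⁻¹ * s (a g x₀) ∈ H := by
          rw [hH, map_mul, Equiv.Perm.mul_apply, hs, map_inv, Equiv.Perm.inv_eq_iff_eq]
        have := δ.2 g (g⁻¹ * s (a g x₀)) x₀
        rw [h0 _ hm, (hH _).1 hm] at this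
        simpa using this
      refine ⟨fun x => δ.1 (s x) x₀, ?_⟩
      apply Subtype.ext
      funext g x
      show δ.1 (s (a g x)) x₀ - δ.1 (s x) x₀ = δ.1 g x
      have h1 := hwd (g * s x)
      rw [map_mul, Equiv.Perm.mul_apply, hs] at h1
      rw [h1, δ.2, hs]
      ring
  have hone : (fun _ : X => (1 : K)) ≠ 0 := fun h => one_ne_zero (congrFun h x₀)
  have e1 := LinearMap.finrank_range_add_finrank_ker B
  have e2 := LinearMap.finrank_range_add_finrank_ker (shapiroMap (K := K) H x₀ hH)
  rw [LinearMap.range_eq_top.2 hsurj, finrank_top, ← hrange] at e2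
  rw [hker, finrank_span_singleton hone, Module.finrank_fintype_fun_eq_card] at e1
  omega

end Cocycles

/-- Induction principle for the normal closure of one element. -/
theorem normalClosure_singleton_induction {G : Type*} [Group G] {r : G} {P : G → Prop}
    (one : P 1) (base : P r)
    (mul : ∀ x ∈ Subgroup.normalClosure {r}, ∀ y ∈ Subgroup.normalClosure {r},
      P x → P y → P (x * y))
    (inv : ∀ x ∈ Subgroup.normalClosure {r}, P x → P x⁻¹)
    (conj : ∀ g, ∀ x ∈ Subgroup.normalClosure {r}, P x → P (g * x * g⁻¹)) :
    ∀ x ∈ Subgroup.normalClosure {r}, P x := by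
  let N : Subgroup G :=
    { carrier := {x | x ∈ Subgroup.normalClosure {r} ∧ P x}
      mul_mem' := fun ha hb => ⟨mul_mem ha.1 hb.1, mul _ ha.1 _ hb.1 ha.2 hb.2⟩
      one_mem' := ⟨one_mem _, one⟩
      inv_mem' := fun ha => ⟨inv_mem ha.1, inv _ ha.1 ha.2⟩ }
  have hN : N.Normal :=
    ⟨fun n hn g => ⟨Subgroup.normalClosure_normal.conj_mem _ hn.1 g, conj g n hn.1 hn.2⟩⟩
  have hle : Subgroup.normalClosure {r} ≤ N := Subgroup.normalClosure_le_normal (by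
    rw [Set.singleton_subset_iff]
    exact ⟨Subgroup.subset_normalClosure rfl, base⟩)
  exact fun x hx => (hle hx).2

/-- The homomorphism `π` exhibits `Γ` as the quotient of a free group by one relator `r`. -/
structure IsOneRelatorPresentation {m : ℕ} {Γ : Type*} [Group Γ] (π : FreeGroup (Fin m) →* Γ)
    (r : FreeGroup (Fin m)) : Prop where
  surjective : Function.Surjective π
  ker_eq : π.ker = Subgroup.normalClosure {r}

theorem IsOneRelatorGroup.exists_presentation {Γ : Type*} [Group Γ] (h : IsOneRelatorGroup Γ) :
    ∃ (m : ℕ) (π : FreeGroup (Fin m) →* Γ) (r : FreeGroup (Fin m)),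
      IsOneRelatorPresentation π r := by
  obtain ⟨m, r, ⟨e⟩⟩ := h
  refine ⟨m, e.symm.toMonoidHom.comp (PresentedGroup.mk {r}), r, ?_, ?_⟩
  · exact e.symm.surjective.comp (QuotientGroup.mk'_surjective _)
  · ext x
    rw [MonoidHom.mem_ker, ← PresentedGroup.mk_eq_one_iff]
    exact map_eq_one_iff e.symm e.symm.injective

theorem IsOneRelatorGroup.of_mulEquiv {Γ Γ' : Type*} [Group Γ] [Group Γ'] (e : Γ' ≃* Γ)
    (h : IsOneRelatorGroup Γ) : IsOneRelatorGroup Γ' := by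
  obtain ⟨m, r, ⟨e'⟩⟩ := h
  exact ⟨m, r, ⟨e.trans e'⟩⟩

section Presentation

variable (K : Type*) [Field K] {m : ℕ} {Γ : Type*} [Group Γ] {X : Type*}

/-- Evaluation of cocycles at the relator (the Fox derivative of the relator). -/
def relatorMap {F : Type*} [Group F] (a : F →* Equiv.Perm X) (r : F) :
    actionCocycles K a →ₗ[K] (X → K) where
  toFun δ := δ.1 r
  map_add' _ _ := rfl
  map_smul' _ _ := rfl

variable {π : FreeGroup (Fin m) →* Γ} {r : FreeGroup (Fin m)}

theorem finrank_cocycles_eq_ker (hπ : IsOneRelatorPresentation π r) (a : Γ →* Equiv.Perm X)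
    (hfin : FiniteDimensional K (actionCocycles K (a.comp π))) :
    FiniteDimensional K (actionCocycles K a) ∧
    Module.finrank K (actionCocycles K a) =
      Module.finrank K (LinearMap.ker (relatorMap K (a.comp π) r)) := by
  have hr : π r = 1 := by
    rw [← MonoidHom.mem_ker, hπ.ker_eq]; exact Subgroup.subset_normalClosure rfl
  let P : actionCocycles K a →ₗ[K] actionCocycles K (a.comp π) :=
    { toFun := fun δ => ⟨fun g => δ.1 (π g), fun g h x => by
        show δ.1 (π (g * h)) x = δ.1 (π g) (a (π h) x) + δ.1 (π h) x
        rw [map_mul, δ.2]⟩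
      map_add' := fun _ _ => rfl
      map_smul' := fun _ _ => rfl }
  have hinj : Function.Injective P := by
    intro δ ε h
    apply Subtype.ext
    funext g
    obtain ⟨g, rfl⟩ := hπ.surjective g
    exact congrFun (congrArg Subtype.val h) g
  have hrange : LinearMap.range P = LinearMap.ker (relatorMap K (a.comp π) r) := by
    apply le_antisymm
    · rintro _ ⟨δ, rfl⟩
      rw [LinearMap.mem_ker]
      funext x
      show δ.1 (π r) x = 0
      rw [hr]; exact actionCocycles_one δ.2 x
    · intro δ hδ
      have htriv : ∀ x ∈ Subgroup.normalClosure {r}, a.comp π x = 1 := by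
        intro x hx
        rw [← hπ.ker_eq] at hx
        simp [MonoidHom.mem_ker.1 hx]
      have hvan : ∀ g ∈ Subgroup.normalClosure {r}, ∀ x, δ.1 g x = 0 := by
        apply normalClosure_singleton_induction
        · exact actionCocycles_one δ.2
        · exact congrFun (LinearMap.mem_ker.1 hδ)
        · intro g _ h _ hg hh x
          rw [δ.2, hg, hh, add_zero]
        · intro g _ hg x
          rw [actionCocycles_inv δ.2, hg, neg_zero]
        · intro g y hy hv x
          rw [actionCocycles_conj δ.2 g y (htriv y hy), hv]
      have hwd : ∀ g h, π g = π h → δ.1 g = δ.1 h := by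
        intro g h hgh
        have hm : h⁻¹ * g ∈ Subgroup.normalClosure {r} := by
          rw [← hπ.ker_eq, MonoidHom.mem_ker, map_mul, hgh, map_inv, inv_mul_cancel]
        funext x
        have := δ.2 h (h⁻¹ * g) x
        rw [hvan _ hm, htriv _ hm] at this
        simpa using this
      obtain ⟨s, hs⟩ := hπ.surjective.hasRightInverse
      refine ⟨⟨fun g => δ.1 (s g), fun g h x => ?_⟩, ?_⟩
      · show δ.1 (s (g * h)) x = δ.1 (s g) (a h x) + δ.1 (s h) x
        rw [hwd _ (s g * s h) (by rw [map_mul, hs, hs, hs]), δ.2, MonoidHom.comp_apply, hs]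
      · apply Subtype.ext
        funext g
        exact hwd _ _ (hs _)
  refine ⟨Module.Finite.of_injective P hinj, ?_⟩
  rw [← hrange, LinearMap.finrank_range_of_inj hinj]

/-- The dimension count for homomorphisms from a point stabiliser of a one-relator group. -/
theorem finrank_hom_stabilizer [Fintype X] (hπ : IsOneRelatorPresentation π r)
    (a : Γ →* Equiv.Perm X) (H : Subgroup Γ) (x₀ : X)
    (hH : ∀ g, g ∈ H ↔ a g x₀ = x₀) (htr : ∀ x, ∃ g, a g x₀ = x) :
    FiniteDimensional K (Additive H →+ K) ∧
    Module.finrank K (Additive H →+ K) + Fintype.card X +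
      Module.finrank K (LinearMap.range (relatorMap K (a.comp π) r)) = m * Fintype.card X + 1 := by
  obtain ⟨hf, hc⟩ := finrank_freeCocycles (K := K) m (a.comp π)
  obtain ⟨hf', hc'⟩ := finrank_cocycles_eq_ker K hπ a hf
  obtain ⟨hf'', hc''⟩ := finrank_actionCocycles H x₀ hH htr hf'
  have := LinearMap.finrank_range_add_finrank_ker (relatorMap K (a.comp π) r)
  exact ⟨hf'', by omega⟩

theorem mem_iff_toPermHom (H : Subgroup Γ) (g : Γ) :
    g ∈ H ↔ MulAction.toPermHom Γ (Γ ⧸ H) g ((1 : Γ) : Γ ⧸ H) = ((1 : Γ) : Γ ⧸ H) := by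
  show _ ↔ g • ((1 : Γ) : Γ ⧸ H) = _
  rw [← MulAction.mem_stabilizer_iff, MulAction.stabilizer_quotient]

/-- The dimension count for homomorphisms from a finite-index subgroup of a one-relator group. -/
theorem finrank_hom_subgroup (hπ : IsOneRelatorPresentation π r) (H : Subgroup Γ)
    (hH : H.FiniteIndex) :
    FiniteDimensional K (Additive H →+ K) ∧
    Module.finrank K (Additive H →+ K) + H.index +
      Module.finrank K (LinearMap.range
        (relatorMap K ((MulAction.toPermHom Γ (Γ ⧸ H)).comp π) r)) = m * H.index + 1 := by
  have : Fintype (Γ ⧸ H) := H.fintypeQuotientOfFiniteIndex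
  rw [Subgroup.index_eq_card, Nat.card_eq_fintype_card]
  refine finrank_hom_stabilizer K hπ _ H ((1 : Γ) : Γ ⧸ H) (mem_iff_toPermHom H) fun x => ?_
  obtain ⟨g, rfl⟩ := QuotientGroup.mk_surjective x
  exact ⟨g, by show g • ((1 : Γ) : Γ ⧸ H) = _; simp⟩

theorem finrank_hom_subgroup_bounds (hπ : IsOneRelatorPresentation π r) (H : Subgroup Γ)
    (hH : H.FiniteIndex) :
    Module.finrank K (Additive H →+ K) + H.index ≤ m * H.index + 1 ∧
    m * H.index + 1 ≤ Module.finrank K (Additive H →+ K) + 2 * H.index := by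
  have : Fintype (Γ ⧸ H) := H.fintypeQuotientOfFiniteIndex
  have h := (finrank_hom_subgroup K hπ H hH).2
  have h2 : Module.finrank K (LinearMap.range
      (relatorMap K ((MulAction.toPermHom Γ (Γ ⧸ H)).comp π) r)) ≤ H.index := by
    refine (Submodule.finrank_le _).trans ?_
    rw [Module.finrank_fintype_fun_eq_card, Subgroup.index_eq_card, Nat.card_eq_fintype_card]
  omega

theorem finrank_hom_congr {Γ' : Type*} [Group Γ'] (e : Γ ≃* Γ') :
    Module.finrank K (Additive Γ →+ K) = Module.finrank K (Additive Γ' →+ K) :=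
  LinearEquiv.finrank_eq
    { toFun := fun f => f.comp e.symm.toMonoidHom.toAdditive
      invFun := fun f => f.comp e.toMonoidHom.toAdditive
      map_add' := fun _ _ => rfl
      map_smul' := fun _ _ => rfl
      left_inv := fun f => by
        ext x; exact congrArg (fun y => f (Additive.ofMul y)) (e.symm_apply_apply x)
      right_inv := fun f => by
        ext x; exact congrArg (fun y => f (Additive.ofMul y)) (e.apply_symm_apply x) }

theorem finrank_hom_bounds (hπ : IsOneRelatorPresentation π r) :
    Module.finrank K (Additive Γ →+ K) ≤ m ∧ m ≤ Module.finrank K (Additive Γ →+ K) + 1 := by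
  have h := finrank_hom_subgroup_bounds K hπ ⊤ inferInstance
  rw [finrank_hom_congr K (Subgroup.topEquiv (G := Γ)), Subgroup.index_top] at h
  omega

end Presentation

/-- Upper triangular square matrices with ones on the diagonal. -/
def IsUnitriangular {N : ℕ} (A : Matrix (Fin N) (Fin N) ℚ) : Prop :=
  (∀ i j, j < i → A i j = 0) ∧ ∀ i, A i i = 1

theorem IsUnitriangular.one {N : ℕ} : IsUnitriangular (1 : Matrix (Fin N) (Fin N) ℚ) :=
  ⟨fun _ _ h => Matrix.one_apply_ne h.ne', fun _ => Matrix.one_apply_eq _⟩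

theorem IsUnitriangular.mul {N : ℕ} {A B : Matrix (Fin N) (Fin N) ℚ} (hA : IsUnitriangular A)
    (hB : IsUnitriangular B) : IsUnitriangular (A * B) := by
  refine ⟨fun i j hij => ?_, fun i => ?_⟩
  · rw [Matrix.mul_apply]
    refine Finset.sum_eq_zero fun k _ => ?_
    rcases lt_or_ge k i with h | h
    · rw [hA.1 i k h, zero_mul]
    · rw [hB.1 k j (hij.trans_le h), mul_zero]
  · rw [Matrix.mul_apply, Finset.sum_eq_single i, hA.2, hB.2, one_mul]
    · intro k _ hk
      rcases lt_or_gt_of_ne hk with h | h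
      · rw [hA.1 i k h, zero_mul]
      · rw [hB.1 k i h, mul_zero]
    · simp

/-- The elements of a group killed by all unitriangular rational representations of size `c`. -/
def unitriangularKernel (E : Type*) [Group E] (c : ℕ) : Subgroup E where
  carrier := {y | ∀ v : E →* Matrix (Fin c) (Fin c) ℚ, (∀ g, IsUnitriangular (v g)) → v y = 1}
  mul_mem' := fun ha hb v hv => by rw [map_mul, ha v hv, hb v hv, one_mul]
  one_mem' := fun v _ => map_one v
  inv_mem' := fun {x} ha v hv => by
    have := map_mul v x x⁻¹
    rw [mul_inv_cancel, map_one, ha v hv, one_mul] at this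
    exact this.symm

section Unitriangular

variable {E : Type*} [Group E]

theorem unitriangularKernel_conj {c : ℕ} {y : E} (hy : y ∈ unitriangularKernel E c) (g : E) :
    g * y * g⁻¹ ∈ unitriangularKernel E c := by
  intro v hv
  rw [map_mul, map_mul, hy v hv, mul_one, ← map_mul, mul_inv_cancel, map_one]

theorem unitriangularKernel_map {E' : Type*} [Group E'] {c : ℕ} {y : E}
    (hy : y ∈ unitriangularKernel E c) (κ : E →* E') : κ y ∈ unitriangularKernel E' c :=
  fun v hv => hy (v.comp κ) fun g => hv (κ g)

theorem mem_unitriangularKernel_one (y : E) : y ∈ unitriangularKernel E 1 := by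
  intro v hv
  ext i j
  rw [Subsingleton.elim j i, (hv y).2, Matrix.one_apply_eq]

/-- The upper left block of a unitriangular representation. -/
def upperBlock {c : ℕ} (u : E →* Matrix (Fin (c + 1)) (Fin (c + 1)) ℚ)
    (hu : ∀ g, IsUnitriangular (u g)) : E →* Matrix (Fin c) (Fin c) ℚ where
  toFun g := (u g).submatrix Fin.castSucc Fin.castSucc
  map_one' := by rw [map_one]; exact Matrix.submatrix_one _ (Fin.castSucc_injective c)
  map_mul' g h := by
    ext i j
    rw [map_mul, Matrix.submatrix_apply, Matrix.mul_apply, Fin.sum_univ_castSucc,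
      (hu h).1 _ _ (Fin.castSucc_lt_last j), mul_zero, add_zero]
    rfl

/-- The lower right block of a unitriangular representation. -/
def lowerBlock {c : ℕ} (u : E →* Matrix (Fin (c + 1)) (Fin (c + 1)) ℚ)
    (hu : ∀ g, IsUnitriangular (u g)) : E →* Matrix (Fin c) (Fin c) ℚ where
  toFun g := (u g).submatrix Fin.succ Fin.succ
  map_one' := by rw [map_one]; exact Matrix.submatrix_one _ (Fin.succ_injective c)
  map_mul' g h := by
    ext i j
    rw [map_mul, Matrix.submatrix_apply, Matrix.mul_apply, Fin.sum_univ_succ,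
      (hu g).1 _ _ (Fin.succ_pos i), zero_mul, zero_add]
    rfl

theorem unitriangular_eq_corner {c : ℕ} (hc : 0 < c)
    (u : E →* Matrix (Fin (c + 1)) (Fin (c + 1)) ℚ) (hu : ∀ g, IsUnitriangular (u g)) {y : E}
    (hy : y ∈ unitriangularKernel E c) :
    u y = 1 + Matrix.single 0 (Fin.last c) (u y 0 (Fin.last c)) := by
  have h0l : (0 : Fin (c + 1)) ≠ Fin.last c := by
    intro h; have := congrArg Fin.val h; simp at this; omega
  have h1 := hy (upperBlock u hu) fun g =>
    ⟨fun i j h => (hu g).1 _ _ (Fin.castSucc_lt_castSucc_iff.2 h), fun i => (hu g).2 _⟩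
  have h2 := hy (lowerBlock u hu) fun g =>
    ⟨fun i j h => (hu g).1 _ _ (Fin.succ_lt_succ_iff.2 h), fun i => (hu g).2 _⟩
  ext i j
  by_cases hij : i = 0 ∧ j = Fin.last c
  · obtain ⟨rfl, rfl⟩ := hij
    rw [Matrix.add_apply, Matrix.one_apply_ne h0l, Matrix.single_apply_same, zero_add]
  · rw [Matrix.add_apply, Matrix.single_apply, if_neg (fun h => hij ⟨h.1.symm, h.2.symm⟩),
      add_zero]
    rcases Fin.eq_castSucc_or_eq_last j with ⟨j, rfl⟩ | rfl
    · rcases Fin.eq_castSucc_or_eq_last i with ⟨i, rfl⟩ | rfl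
      · have := congrFun (congrFun h1 i) j
        rw [← Matrix.submatrix_one _ (Fin.castSucc_injective c)] at this
        exact this
      · rw [(hu y).1 _ _ (Fin.castSucc_lt_last j), Matrix.one_apply_ne (Fin.castSucc_lt_last j).ne']
    · obtain ⟨i, rfl⟩ := Fin.exists_succ_eq.2 (fun h => hij ⟨h, rfl⟩)
      obtain ⟨j, hj⟩ := Fin.exists_succ_eq.2 h0l.symm
      rw [← hj]
      have := congrFun (congrFun h2 i) j
      rw [← Matrix.submatrix_one _ (Fin.succ_injective c)] at this
      exact this

/-- Successive quotients of the filtration by unitriangular kernels are detected by additive,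
conjugation invariant functions. -/
theorem exists_additive_of_notMem_unitriangularKernel {c : ℕ} (hc : 0 < c) {y : E}
    (hy : y ∈ unitriangularKernel E c) (hy' : y ∉ unitriangularKernel E (c + 1)) :
    ∃ f : E → ℚ, f y ≠ 0 ∧
      (∀ a ∈ unitriangularKernel E c, ∀ b ∈ unitriangularKernel E c, f (a * b) = f a + f b) ∧
      (∀ g, ∀ a ∈ unitriangularKernel E c, f (g * a * g⁻¹) = f a) ∧
      ∀ a ∈ unitriangularKernel E (c + 1), f a = 0 := by
  have h0l : (0 : Fin (c + 1)) ≠ Fin.last c := by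
    intro h; have := congrArg Fin.val h; simp at this; omega
  obtain ⟨u, hu, hne⟩ : ∃ u : E →* Matrix (Fin (c + 1)) (Fin (c + 1)) ℚ,
      (∀ g, IsUnitriangular (u g)) ∧ u y ≠ 1 := by
    by_contra hcon
    push Not at hcon
    exact hy' hcon
  have key : ∀ a ∈ unitriangularKernel E c, _ := fun a ha => unitriangular_eq_corner hc u hu ha
  refine ⟨fun g => u g 0 (Fin.last c), fun h => hne ?_, fun a ha b hb => ?_, fun g a ha => ?_,
    fun a ha => ?_⟩
  · rw [key y hy]
    simp only at h
    rw [h, Matrix.single_zero, add_zero]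
  · show u (a * b) 0 (Fin.last c) = _
    rw [map_mul, key a ha, key b hb]
    simp [add_mul, mul_add, h0l, h0l.symm, add_comm]
  · show u (g * a * g⁻¹) 0 (Fin.last c) = u a 0 (Fin.last c)
    have h1 : ∀ t, u g * Matrix.single 0 (Fin.last c) t = Matrix.single 0 (Fin.last c) t := by
      intro t
      ext i j
      by_cases hj : j = Fin.last c
      · subst hj
        rw [Matrix.mul_single_apply_same]
        by_cases hi : i = 0
        · subst hi; simp [(hu g).2]
        · rw [(hu g).1 i 0 (Fin.pos_iff_ne_zero.2 hi), zero_mul, Matrix.single_apply,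
            if_neg (fun h => hi h.1.symm)]
      · rw [Matrix.mul_single_apply_of_ne _ _ _ _ _ hj, Matrix.single_apply,
          if_neg (fun h => hj h.2.symm)]
    have h2 : ∀ t, Matrix.single 0 (Fin.last c) t * u g⁻¹ = Matrix.single 0 (Fin.last c) t := by
      intro t
      ext i j
      by_cases hi : i = 0
      · subst hi
        rw [Matrix.single_mul_apply_same]
        by_cases hj : j = Fin.last c
        · subst hj; simp [(hu _).2]
        · rw [(hu _).1 _ _ (Fin.lt_last_iff_ne_last.2 hj), mul_zero, Matrix.single_apply,
            if_neg (fun h => hj h.2.symm)]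
      · rw [Matrix.single_mul_apply_of_ne _ _ _ _ _ hi, Matrix.single_apply,
          if_neg (fun h => hi h.1.symm)]
    have h3 : u (g * a * g⁻¹) = u a := by
      rw [map_mul, map_mul, key a ha, mul_add, add_mul, h1, h2, mul_one, ← map_mul,
        mul_inv_cancel, map_one]
    rw [h3]
  · show u a 0 (Fin.last c) = 0
    rw [ha u hu, Matrix.one_apply_ne h0l]

end Unitriangular

section Residual

variable {α : Type*}

/-- The shift matrix moving along the positions of a list whose label is `x`. -/
noncomputable def labelShift (l : ℕ) (L : ℕ → α) (x : α) : Matrix (Fin (l + 1)) (Fin (l + 1)) ℚ :=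
  open Classical in Matrix.of fun i j => if (j : ℕ) = i + 1 ∧ L i = x then 1 else 0

theorem labelShift_mul_apply (l : ℕ) (L : ℕ → α) (x : α) (A : Matrix (Fin (l + 1)) (Fin (l + 1)) ℚ)
    (i : ℕ) (hi : i < l) (k : Fin (l + 1)) :
    (labelShift l L x * A) ⟨i, by omega⟩ k =
      open Classical in if L i = x then A ⟨i + 1, by omega⟩ k else 0 := by
  classical
  rw [Matrix.mul_apply, Finset.sum_eq_single ⟨i + 1, by omega⟩]
  · simp [labelShift]
  · intro j _ hj
    have : ¬ (j : ℕ) = i + 1 := fun h => hj (Fin.ext h)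
    simp [labelShift, this]
  · simp

theorem labelShift_last_mul_apply (l : ℕ) (L : ℕ → α) (x : α)
    (A : Matrix (Fin (l + 1)) (Fin (l + 1)) ℚ) (k : Fin (l + 1)) :
    (labelShift l L x * A) (Fin.last l) k = 0 := by
  classical
  rw [Matrix.mul_apply]
  refine Finset.sum_eq_zero fun j _ => ?_
  have : ¬ (j : ℕ) = l + 1 := by omega
  simp [labelShift, this]

theorem labelShift_sq (l : ℕ) (L : ℕ → α) (hL : ∀ i, i + 1 < l → L i ≠ L (i + 1)) (x : α) :
    labelShift l L x * labelShift l L x = 0 := by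
  classical
  ext i k
  rcases Fin.eq_castSucc_or_eq_last i with ⟨i, rfl⟩ | rfl
  · have := labelShift_mul_apply l L x (labelShift l L x) i i.2 k
    refine this.trans ?_
    split_ifs with h
    · simp only [labelShift, Matrix.of_apply, Matrix.zero_apply, ite_eq_right_iff, one_ne_zero,
        imp_false, not_and]
      intro hk h'
      exact hL i (by omega) (h.trans h'.symm)
    · rfl
  · exact labelShift_last_mul_apply l L x _ k

/-- The unipotent representation `m ↦ 1 + e(m) A` attached to a square-zero matrix. -/
noncomputable def unipotentRep {N : ℕ} (A : Matrix (Fin N) (Fin N) ℚ) (hA : A * A = 0) :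
    FreeGroup Unit →* Matrix (Fin N) (Fin N) ℚ where
  toFun m := 1 + ((FreeGroup.mulEquivIntOfUnique m).toAdd : ℚ) • A
  map_one' := by simp
  map_mul' g h := by
    rw [map_mul, toAdd_mul, Int.cast_add, add_smul]
    simp only [add_mul, mul_add, Matrix.smul_mul, Matrix.mul_smul, hA, smul_zero, one_mul, mul_one]
    abel

theorem unipotentRep_apply {N : ℕ} (A : Matrix (Fin N) (Fin N) ℚ) (hA : A * A = 0)
    (m : FreeGroup Unit) :
    unipotentRep A hA m = 1 + ((FreeGroup.mulEquivIntOfUnique m).toAdd : ℚ) • A := rfl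

theorem prod_unipotentRep_corner (l : ℕ) (L : ℕ → α)
    (hL : ∀ i, i + 1 < l → L i ≠ L (i + 1)) (T : List (Σ _ : α, FreeGroup Unit)) (s : ℕ)
    (hs : s + T.length = l) (hT : ∀ i (hi : i < T.length), L (s + i) = T[i].1) (i : ℕ)
    (hi : i ≤ s) :
    (T.map fun t => unipotentRep (labelShift l L t.1) (labelShift_sq l L hL t.1) t.2).prod
      ⟨i, by omega⟩ (Fin.last l) = if i = s then
        (T.map fun t => ((FreeGroup.mulEquivIntOfUnique t.2).toAdd : ℚ)).prod else 0 := by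
  induction T generalizing s i with
  | nil =>
    have hs' : s = l := by simpa using hs
    subst hs'
    simp only [List.map_nil, List.prod_nil, Matrix.one_apply, Fin.ext_iff, Fin.val_last]
  | cons t T ih =>
    simp only [List.length_cons] at hs
    have ih' := ih (s + 1) (by omega) (fun i hi => by
      have := hT (i + 1) (by simpa using hi)
      rw [List.getElem_cons_succ] at this
      rw [← this]; congr 1; omega)
    have h0 : L s = t.1 := hT 0 (by simp)
    rw [List.map_cons, List.prod_cons, unipotentRep_apply, add_mul, one_mul, Matrix.add_apply,
      Matrix.smul_mul, Matrix.smul_apply, labelShift_mul_apply l L _ _ i (by omega),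
      ih' i (by omega), ih' (i + 1) (by omega), if_neg (by omega : i ≠ s + 1), zero_add]
    by_cases his : i = s
    · subst his
      simp [h0]
    · simp [his]

/-- Free groups are residually unitriangular. -/
theorem exists_notMem_unitriangularKernel {ρ : FreeGroup α} (hρ : ρ ≠ 1) :
    ∃ c, ρ ∉ unitriangularKernel (FreeGroup α) c := by
  classical
  set w := Monoid.CoprodI.Word.equiv (freeGroupEquivCoprodI ρ) with hw
  have hwp : w.prod = freeGroupEquivCoprodI ρ :=
    Monoid.CoprodI.Word.equiv.symm_apply_apply (freeGroupEquivCoprodI ρ)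
  have hne : w.toList ≠ [] := by
    intro h
    apply hρ
    rw [Monoid.CoprodI.Word.prod, h, List.map_nil, List.prod_nil] at hwp
    exact (map_eq_one_iff _ freeGroupEquivCoprodI.injective).1 hwp.symm
  obtain ⟨t₀, ht₀⟩ := List.exists_mem_of_ne_nil _ hne
  set l := w.toList.length with hl
  let L : ℕ → α := fun i => (w.toList[i]?.map Sigma.fst).getD t₀.1
  have hLget : ∀ i (hi : i < w.toList.length), L i = w.toList[i].1 := by
    intro i hi
    simp [L, hi]
  have hL : ∀ i, i + 1 < l → L i ≠ L (i + 1) := by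
    intro i hi
    rw [hLget i (by omega), hLget (i + 1) hi]
    exact List.isChain_iff_getElem.1 w.chain_ne i hi
  let V : Monoid.CoprodI (fun _ : α => FreeGroup Unit) →* Matrix (Fin (l + 1)) (Fin (l + 1)) ℚ :=
    Monoid.CoprodI.lift fun x => unipotentRep (labelShift l L x) (labelShift_sq l L hL x)
  have hV : ∀ g, IsUnitriangular (V g) := by
    intro g
    induction g using Monoid.CoprodI.induction_on with
    | one => rw [map_one]; exact IsUnitriangular.one
    | of x m =>
      rw [Monoid.CoprodI.lift_of, unipotentRep_apply]
      constructor
      · intro i j hij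
        have : ¬ (j : ℕ) = i + 1 := by have := Fin.lt_def.1 hij; omega
        simp [labelShift, this, hij.ne']
      · intro i
        simp [labelShift]
    | mul g h hg hh => rw [map_mul]; exact hg.mul hh
  refine ⟨l + 1, fun hmem => ?_⟩
  have h1 := hmem (V.comp freeGroupEquivCoprodI.toMonoidHom) fun g => hV _
  have h2 : V (freeGroupEquivCoprodI ρ) = (w.toList.map fun t =>
      unipotentRep (labelShift l L t.1) (labelShift_sq l L hL t.1) t.2).prod := by
    rw [← hwp, Monoid.CoprodI.Word.prod, map_list_prod, List.map_map]
    congr 1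
  have h3 := prod_unipotentRep_corner l L hL w.toList 0 (by omega)
    (fun i hi => by rw [zero_add]; exact hLget i hi) 0 le_rfl
  rw [← h2, if_pos rfl] at h3
  have h4 : V (freeGroupEquivCoprodI ρ) = 1 := h1
  rw [h4, Matrix.one_apply_ne] at h3
  · rw [eq_comm, List.prod_eq_zero_iff, List.mem_map] at h3
    obtain ⟨t, ht, ht0⟩ := h3
    apply w.ne_one t ht
    rw [Int.cast_eq_zero] at ht0
    exact (map_eq_one_iff _ FreeGroup.mulEquivIntOfUnique.injective).1 ht0
  · intro h
    have hpos : 0 < l := List.length_pos_iff.2 hne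
    have := congrArg Fin.val h
    simp at this
    omega

end Residual

section Extension

variable {F Γ : Type*} [Group F] [Group Γ] {K : Type*} [Field K]

/-- For a surjection `π` onto a group containing a one-relator subgroup `N`, the obstruction to
extending an invariant homomorphism from `π.ker` to `N.comap π` is its value at one element. -/
theorem exists_extension_obstruction (π : F →* Γ) (hπ : Function.Surjective π) (N : Subgroup Γ)
    (hN : IsOneRelatorGroup N) :
    ∃ σ : F, ∀ η : F → K, (∀ x ∈ π.ker, ∀ y ∈ π.ker, η (x * y) = η x + η y) →
      (∀ g ∈ N.comap π, ∀ x ∈ π.ker, η (g * x * g⁻¹) = η x) → η σ = 0 →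
      ∃ η' : Additive (N.comap π) →+ K, ∀ (x : F) (_ : x ∈ π.ker) (hx' : x ∈ N.comap π),
        η' (Additive.ofMul ⟨x, hx'⟩) = η x := by
  obtain ⟨M, q, s, hq⟩ := hN.exists_presentation
  choose t ht using fun i => hπ (q (FreeGroup.of i) : Γ)
  let qt : FreeGroup (Fin M) →* F := FreeGroup.lift t
  have hqt : ∀ y, π (qt y) = q y := by
    have : π.comp qt = N.subtype.comp q := by
      ext i
      simp [qt, ht]
    exact fun y => DFunLike.congr_fun this y
  have hqker : ∀ y ∈ Subgroup.normalClosure {s}, qt y ∈ π.ker := by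
    intro y hy
    rw [← hq.ker_eq, MonoidHom.mem_ker] at hy
    rw [MonoidHom.mem_ker, hqt, hy]
    rfl
  refine ⟨qt s, fun η hadd hinv hσ => ?_⟩
  have hone : η 1 = 0 := by simpa using hadd 1 (one_mem _) 1 (one_mem _)
  have hvan : ∀ y ∈ Subgroup.normalClosure {s}, η (qt y) = 0 := by
    apply normalClosure_singleton_induction
    · rw [map_one, hone]
    · exact hσ
    · intro x hx y hy hx0 hy0
      rw [map_mul, hadd _ (hqker x hx) _ (hqker y hy), hx0, hy0, add_zero]
    · intro x hx hx0
      have := hadd _ (hqker x hx) _ (inv_mem (hqker x hx))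
      rw [mul_inv_cancel, hone, hx0, zero_add] at this
      rw [map_inv, ← this]
    · intro g x hx hx0
      rw [map_mul, map_mul, map_inv, hinv _ _ _ (hqker x hx), hx0]
      rw [Subgroup.mem_comap, hqt]
      exact (q g).2
  choose y hy using fun x : N.comap π => hq.surjective ⟨π x, x.2⟩
  have hmem : ∀ (x : N.comap π) z, q z = ⟨π x, x.2⟩ → x * (qt z)⁻¹ ∈ π.ker := by
    intro x z hz
    rw [MonoidHom.mem_ker, map_mul, map_inv, hqt, hz, mul_inv_cancel]
  have hwd : ∀ (x : N.comap π) z, q z = ⟨π x, x.2⟩ →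
      η (x * (qt (y x))⁻¹) = η (x * (qt z)⁻¹) := by
    intro x z hz
    have h1 : z * (y x)⁻¹ ∈ Subgroup.normalClosure {s} := by
      rw [← hq.ker_eq, MonoidHom.mem_ker, map_mul, map_inv, hz, hy, mul_inv_cancel]
    have h2 : (x : F) * (qt (y x))⁻¹ = x * (qt z)⁻¹ * qt (z * (y x)⁻¹) := by
      simp [mul_assoc]
    rw [h2, hadd _ (hmem x z hz) _ (hqker _ h1), hvan _ h1, add_zero]
  refine ⟨AddMonoidHom.mk' (fun x => η (x.toMul * (qt (y x.toMul))⁻¹)) fun x₁ x₂ => ?_,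
    fun x hx hx' => ?_⟩
  · obtain ⟨x₁, rfl⟩ := Additive.ofMul.surjective x₁
    obtain ⟨x₂, rfl⟩ := Additive.ofMul.surjective x₂
    rw [← ofMul_mul, toMul_ofMul, toMul_ofMul, toMul_ofMul,
      hwd (x₁ * x₂) (y x₁ * y x₂) (by rw [map_mul, hy, hy]; ext; simp)]
    have h : ((x₁ * x₂ : N.comap π) : F) * (qt (y x₁ * y x₂))⁻¹ =
        (x₁ * (x₂ * (qt (y x₂))⁻¹) * (x₁ : F)⁻¹) * (x₁ * (qt (y x₁))⁻¹) := by
      simp [mul_assoc]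
    rw [h, hadd _ ((inferInstance : π.ker.Normal).conj_mem _ (hmem x₂ _ (hy x₂)) _) _
      (hmem x₁ _ (hy x₁)), hinv _ x₁.2 _ (hmem x₂ _ (hy x₂)), add_comm]
  · have h := hwd ⟨x, hx'⟩ 1 (by rw [map_one]; ext; exact (MonoidHom.mem_ker.1 hx).symm)
    refine h.trans ?_
    simp

/-- A lower bound for the rank of the relator map, when the point stabiliser is a one-relator
group, from a family of invariant homomorphisms on the kernel of the presentation. -/
theorem card_le_finrank_relatorMap {m : ℕ} {X ι : Type*} [Fintype X] [Fintype ι]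
    {π : FreeGroup (Fin m) →* Γ} {r : FreeGroup (Fin m)} (hπ : IsOneRelatorPresentation π r)
    (a : Γ →* Equiv.Perm X) (H : Subgroup Γ) (x₀ : X)
    (hH : ∀ g, g ∈ H ↔ a g x₀ = x₀) (htr : ∀ x, ∃ g, a g x₀ = x) (hone : IsOneRelatorGroup H)
    (α : ι → FreeGroup (Fin m) → K)
    (hadd : ∀ i, ∀ x ∈ π.ker, ∀ y ∈ π.ker, α i (x * y) = α i x + α i y)
    (hinv : ∀ i, ∀ g ∈ H.comap π, ∀ x ∈ π.ker, α i (g * x * g⁻¹) = α i x)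
    (hinj : ∀ v : ι → K, (∀ g, ∑ i, v i * α i (g⁻¹ * r * g) = 0) → v = 0) :
    Fintype.card ι ≤ Module.finrank K (LinearMap.range (relatorMap K (a.comp π) r)) + 1 := by
  obtain ⟨σ, hσ⟩ := exists_extension_obstruction (K := K) π hπ.surjective H hone
  have hr : r ∈ π.ker := by rw [hπ.ker_eq]; exact Subgroup.subset_normalClosure rfl
  have hat : ∀ x ∈ π.ker, a.comp π x = 1 := by
    intro x hx
    rw [MonoidHom.comp_apply, MonoidHom.mem_ker.1 hx, map_one]
  have htr' : ∀ x, ∃ g, a.comp π g x₀ = x := by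
    intro x
    obtain ⟨g, hg⟩ := htr x
    obtain ⟨g, rfl⟩ := hπ.surjective g
    exact ⟨g, hg⟩
  choose s hs using htr'
  have hs' : ∀ g, g⁻¹ * s (a.comp π g x₀) ∈ H.comap π := by
    intro g
    rw [Subgroup.mem_comap, hH]
    show a.comp π (g⁻¹ * s (a.comp π g x₀)) x₀ = x₀
    rw [map_mul, Equiv.Perm.mul_apply, hs, map_inv, Equiv.Perm.inv_eq_iff_eq]
  have hwd : ∀ i g, α i (g⁻¹ * r * g) =
      α i ((s (a.comp π g x₀))⁻¹ * r * s (a.comp π g x₀)) := by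
    intro i g
    have h1 : g⁻¹ * r * g = g⁻¹ * s (a.comp π g x₀) * ((s (a.comp π g x₀))⁻¹ * r *
        s (a.comp π g x₀)) * (g⁻¹ * s (a.comp π g x₀))⁻¹ := by group
    rw [h1, hinv i _ (hs' g)]
    simpa using (inferInstance : π.ker.Normal).conj_mem r hr (s (a.comp π g x₀))⁻¹
  let T : (ι → K) →ₗ[K] (X → K) :=
    { toFun := fun v x => ∑ i, v i * α i ((s x)⁻¹ * r * s x)
      map_add' := fun v v' => by
        funext x; simp [add_mul, Finset.sum_add_distrib]
      map_smul' := fun c v => by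
        funext x; simp [Finset.mul_sum, mul_assoc] }
  let o : (ι → K) →ₗ[K] K :=
    { toFun := fun v => ∑ i, v i * α i σ
      map_add' := fun v v' => by simp [add_mul, Finset.sum_add_distrib]
      map_smul' := fun c v => by simp [Finset.mul_sum, mul_assoc] }
  have hT : Function.Injective T := by
    rw [injective_iff_map_eq_zero]
    intro v hv
    refine hinj v fun g => ?_
    simp only [hwd _ g]
    exact congrFun hv _
  have hle : (LinearMap.ker o).map T ≤ LinearMap.range (relatorMap K (a.comp π) r) := by
    rintro _ ⟨v, hv, rfl⟩
    obtain ⟨η, hη⟩ := hσ (fun x => ∑ i, v i * α i x)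
      (fun x hx y hy => by simp [hadd _ x hx y hy, mul_add, Finset.sum_add_distrib])
      (fun g hg x hx => by simp only [hinv _ g hg x hx]) hv
    obtain ⟨δ, hδ⟩ := shapiroMap_surjective (K := K) (a := a.comp π) (H.comap π) x₀
      (fun g => hH (π g)) (fun x => ⟨s x, hs x⟩) η
    refine ⟨δ, ?_⟩
    funext x
    have hk : (s x)⁻¹ * r * s x ∈ π.ker := by
      simpa using (inferInstance : π.ker.Normal).conj_mem r hr (s x)⁻¹
    have hk' : (s x)⁻¹ * r * s x ∈ H.comap π := by
      rw [Subgroup.mem_comap, MonoidHom.mem_ker.1 hk]; exact one_mem _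
    have h1 := hη _ hk hk'
    rw [← hδ] at h1
    have h2 := actionCocycles_conj δ.2 (s x)⁻¹ r (hat r hr) x₀
    rw [inv_inv, hs] at h2
    exact h2.symm.trans h1
  have h1 := Submodule.finrank_mono hle
  rw [← (Submodule.equivMapOfInjective T hT (LinearMap.ker o)).finrank_eq] at h1
  have h2 := LinearMap.finrank_range_add_finrank_ker o
  have h3 : Module.finrank K (LinearMap.range o) ≤ 1 := by
    simpa using Submodule.finrank_le (LinearMap.range o)
  rw [Module.finrank_fintype_fun_eq_card] at h2
  omega

end Extension

theorem exists_hom_int_relator {m : ℕ} (hm : 2 ≤ m) (r : FreeGroup (Fin m)) :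
    ∃ φ : FreeGroup (Fin m) →* Multiplicative ℤ, φ r = 1 ∧ ∃ j, φ (FreeGroup.of j) ≠ 1 := by
  let e : Fin m → FreeGroup (Fin m) →* Multiplicative ℤ := fun i =>
    FreeGroup.lift fun j => if j = i then Multiplicative.ofAdd 1 else 1
  have he : ∀ i j, e i (FreeGroup.of j) = if j = i then Multiplicative.ofAdd 1 else 1 := by
    intro i j; simp [e]
  let i₀ : Fin m := ⟨0, by omega⟩
  let i₁ : Fin m := ⟨1, by omega⟩
  have h01 : i₁ ≠ i₀ := by simp [i₀, i₁]
  by_cases h : e i₀ r = 1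
  · exact ⟨e i₀, h, i₀, by rw [he, if_pos rfl]; decide⟩
  · refine ⟨e i₁ ^ (e i₀ r).toAdd * (e i₀ ^ (e i₁ r).toAdd)⁻¹, ?_, i₁, ?_⟩
    · rw [MonoidHom.mul_apply, MonoidHom.inv_apply, MonoidHom.zpow_apply, MonoidHom.zpow_apply,
        mul_inv_eq_one]
      apply Multiplicative.toAdd.injective
      rw [toAdd_zpow, toAdd_zpow, smul_eq_mul, smul_eq_mul, mul_comm]
    · rw [MonoidHom.mul_apply, MonoidHom.inv_apply, MonoidHom.zpow_apply, MonoidHom.zpow_apply,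
        he, he, if_pos rfl, if_neg h01, one_zpow, inv_one, mul_one]
      intro h'
      apply h
      have := congrArg Multiplicative.toAdd h'
      rw [toAdd_zpow, toAdd_ofAdd, smul_eq_mul, mul_one] at this
      exact Multiplicative.toAdd.injective this

/-- The translation action on a ring attached to an integer-valued homomorphism. -/
def translation {F : Type*} [Group F] (A : Type*) [Ring A] (φ : F →* Multiplicative ℤ) :
    F →* Equiv.Perm A where
  toFun g := Equiv.addLeft (((φ g).toAdd : ℤ) : A)
  map_one' := by ext x; simp
  map_mul' g h := by ext x; simp

theorem translation_apply {F : Type*} [Group F] {A : Type*} [Ring A] (φ : F →* Multiplicative ℤ)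
    (g : F) (x : A) : translation A φ g x = ((φ g).toAdd : ℤ) + x := rfl

section Cut

variable {S : Type*}

/-- The endomorphism killing the letters of level less than `i`. -/
noncomputable def cutBelow (i : ℤ) : FreeGroup (S × ℤ) →* FreeGroup (S × ℤ) :=
  FreeGroup.lift fun y => if i ≤ y.2 then FreeGroup.of y else 1

/-- The endomorphism shifting the levels of letters by `d`. -/
def shiftLevel (d : ℤ) : FreeGroup (S × ℤ) →* FreeGroup (S × ℤ) :=
  FreeGroup.map fun y => (y.1, y.2 + d)

theorem shiftLevel_shiftLevel (d e : ℤ) (y : FreeGroup (S × ℤ)) :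
    shiftLevel d (shiftLevel e y) = shiftLevel (e + d) y := by
  have : (shiftLevel d).comp (shiftLevel e) = shiftLevel (S := S) (e + d) := by
    ext y
    simp [shiftLevel, add_assoc]
  exact DFunLike.congr_fun this y

theorem shiftLevel_zero (y : FreeGroup (S × ℤ)) : shiftLevel 0 y = y := by
  have : shiftLevel (S := S) 0 = MonoidHom.id _ := by
    ext y
    simp [shiftLevel]
  exact DFunLike.congr_fun this y

theorem cutBelow_shiftLevel (i d : ℤ) (y : FreeGroup (S × ℤ)) :
    cutBelow i (shiftLevel d y) = shiftLevel d (cutBelow (i - d) y) := by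
  have : (cutBelow i).comp (shiftLevel d) = (shiftLevel (S := S) d).comp (cutBelow (i - d)) := by
    ext y
    by_cases h : i ≤ y.2 + d
    · simp [shiftLevel, cutBelow, h]
    · simp [shiftLevel, cutBelow, h]
  exact DFunLike.congr_fun this y

/-- Only finitely many levels occur in an element of a free group. -/
theorem exists_level_bound (ρ : FreeGroup (S × ℤ)) :
    ∃ w : ℕ, ∀ κ κ' : FreeGroup (S × ℤ) →* FreeGroup (S × ℤ),
      (∀ y : S × ℤ, |y.2| ≤ w → κ (FreeGroup.of y) = κ' (FreeGroup.of y)) → κ ρ = κ' ρ := by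
  induction ρ using FreeGroup.induction_on with
  | C1 => exact ⟨0, fun κ κ' _ => by rw [map_one, map_one]⟩
  | of y => exact ⟨y.2.natAbs, fun κ κ' h => h y (Int.abs_eq_natAbs _).le⟩
  | inv_of y ih =>
    obtain ⟨w, hw⟩ := ih
    exact ⟨w, fun κ κ' h => by rw [map_inv, map_inv, hw κ κ' h]⟩
  | mul x y hx hy =>
    obtain ⟨w, hw⟩ := hx
    obtain ⟨w', hw'⟩ := hy
    refine ⟨max w w', fun κ κ' h => ?_⟩
    rw [map_mul, map_mul, hw κ κ' fun y hy => h y (hy.trans (by simp)),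
      hw' κ κ' fun y hy => h y (hy.trans (by simp))]

/-- A nontrivial element has a detectable leading level. -/
theorem exists_leading_level {ρ : FreeGroup (S × ℤ)} (hρ : ρ ≠ 1) :
    ∃ (c : ℕ) (i₀ : ℤ) (f : FreeGroup (S × ℤ) → ℚ),
      ρ ∈ unitriangularKernel (FreeGroup (S × ℤ)) c ∧
      (∀ a ∈ unitriangularKernel _ c, ∀ b ∈ unitriangularKernel _ c, f (a * b) = f a + f b) ∧
      (∀ g, ∀ a ∈ unitriangularKernel _ c, f (g * a * g⁻¹) = f a) ∧
      f (cutBelow i₀ ρ) ≠ 0 ∧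
      ∀ i, i₀ < i → ∀ κ : FreeGroup (S × ℤ) →* FreeGroup (S × ℤ), f (κ (cutBelow i ρ)) = 0 := by
  classical
  have hex : ∃ c, ρ ∉ unitriangularKernel (FreeGroup (S × ℤ)) (c + 1) := by
    obtain ⟨c, hc⟩ := exists_notMem_unitriangularKernel hρ
    refine ⟨c - 1, ?_⟩
    have : c ≠ 0 := by
      rintro rfl
      exact hc fun v _ => Subsingleton.elim _ _
    rwa [Nat.sub_add_cancel (Nat.one_le_iff_ne_zero.2 this)]
  set c := Nat.find hex with hcdef
  have hc : ρ ∉ unitriangularKernel (FreeGroup (S × ℤ)) (c + 1) := Nat.find_spec hex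
  have hc0 : 0 < c := by
    rw [Nat.pos_iff_ne_zero]
    intro h
    rw [h] at hc
    exact hc (mem_unitriangularKernel_one ρ)
  have hcmem : ρ ∈ unitriangularKernel (FreeGroup (S × ℤ)) c := by
    have := Nat.find_min hex (m := c - 1) (by omega)
    rwa [not_not, Nat.sub_add_cancel hc0] at this
  obtain ⟨w, hw⟩ := exists_level_bound ρ
  obtain ⟨i₀, hi₀, hmax⟩ : ∃ i₀ : ℤ, cutBelow i₀ ρ ∉ unitriangularKernel _ (c + 1) ∧
      ∀ i, cutBelow i ρ ∉ unitriangularKernel _ (c + 1) → i ≤ i₀ := by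
    apply Int.exists_greatest_of_bdd
    · refine ⟨w, fun i hi => ?_⟩
      by_contra hlt
      apply hi
      have := hw (cutBelow i) 1 fun y hy => by
        have h : ¬ i ≤ y.2 := by have := abs_le.1 hy; omega
        simp [cutBelow, h]
      rw [this]
      exact one_mem _
    · refine ⟨-w, ?_⟩
      have := hw (cutBelow (-w)) (MonoidHom.id _) fun y hy => by
        have h : -(w : ℤ) ≤ y.2 := (abs_le.1 hy).1
        simp [cutBelow, h]
      rw [this]
      exact hc
  obtain ⟨f, hf, hadd, hconj, hvan⟩ := exists_additive_of_notMem_unitriangularKernel hc0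
    (unitriangularKernel_map hcmem (cutBelow i₀)) hi₀
  refine ⟨c, i₀, f, hcmem, hadd, hconj, hf, fun i hi κ => hvan _ (unitriangularKernel_map ?_ κ)⟩
  by_contra h
  exact absurd (hmax i h) (by omega)

end Cut

/-- A nontrivial element of a free group, written with levels recording the position in a
`ℤ`-action: nontrivial crossed value at the origin. -/
theorem exists_crossed_levels {S : Type*} (φ : FreeGroup S →* Multiplicative ℤ) {r : FreeGroup S}
    (hr : r ≠ 1) :
    ∃ δ : FreeGroup S → ℤ → FreeGroup (S × ℤ),
      (∀ g h x, δ (g * h) x = δ g (translation ℤ φ h x) * δ h x) ∧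
      (∀ j x, δ (FreeGroup.of j) x = FreeGroup.of (j, x)) ∧ δ r 0 ≠ 1 := by
  obtain ⟨δ, hδ, hof⟩ := exists_crossed (translation ℤ φ) (fun j x => FreeGroup.of (j, x))
  refine ⟨δ, hδ, hof, fun h => hr ?_⟩
  have := crossed_unique (b := (1 : FreeGroup S →* Equiv.Perm Unit)) (fun _ => ())
    (fun _ _ => rfl) (FreeGroup.lift fun y : S × ℤ => FreeGroup.of y.1) hδ
    (ε := fun g _ => g) (fun _ _ _ => rfl) (fun j x => by rw [hof]; simp) r 0
  rw [← this, h, map_one]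

/-- One-relator groups on at least two generators, all of whose finite-index subgroups are
one-relator groups, have arbitrarily deep finite-index subgroups of small first Betti number. -/
theorem exists_small_betti {Γ : Type*} [Group Γ] {m : ℕ} (hm : 2 ≤ m)
    {π : FreeGroup (Fin m) →* Γ} {r : FreeGroup (Fin m)} (hπ : IsOneRelatorPresentation π r)
    (hr : r ≠ 1) (hmel : ∀ H : Subgroup Γ, H.FiniteIndex → IsOneRelatorGroup H) :
    ∃ C : ℕ, ∀ B : ℕ, ∃ k, B ≤ k ∧ ∃ N : Subgroup Γ, N.FiniteIndex ∧ N.index = k ∧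
      Module.finrank ℚ (Additive N →+ ℚ) + 2 * k ≤ m * k + C := by
  obtain ⟨φ, hφr, j₀, hj₀⟩ := exists_hom_int_relator hm r
  obtain ⟨δ, hδ, hδof, hρ⟩ := exists_crossed_levels φ hr
  obtain ⟨w, hw⟩ := exists_level_bound (δ r 0)
  obtain ⟨c, i₀, f, hρc, hfadd, hfconj, hf0, hfvan⟩ := exists_leading_level hρ
  refine ⟨2 * w + 2, fun B => ?_⟩
  set n : ℤ := (φ (FreeGroup.of j₀)).toAdd with hn
  have hn0 : n ≠ 0 := fun h => hj₀ (Multiplicative.toAdd.injective h)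
  have hn1 : 1 ≤ n.natAbs := Nat.one_le_iff_ne_zero.2 (Int.natAbs_ne_zero.2 hn0)
  let k : ℕ := n.natAbs * B + 1
  have hBk : B ≤ k := (Nat.le_mul_of_pos_left B hn1).trans (Nat.le_succ _)
  have : NeZero k := ⟨by omega⟩
  have hsurj : ∀ b : ℤ, ∃ g, (((φ g).toAdd : ℤ) : ZMod k) = b := by
    intro b
    refine ⟨FreeGroup.of j₀ ^ (-(n.sign * B * b)), ?_⟩
    have h0 : ((n.natAbs * B + 1 : ℕ) : ZMod k) = 0 := ZMod.natCast_self k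
    have h1 : n * (n.sign * B * b) = (n.natAbs * B + 1 : ℕ) * b - b := by
      have := Int.mul_sign_self n
      rw [Int.natCast_natAbs] at this
      push_cast
      linear_combination (B * b : ℤ) * this
    rw [map_zpow, toAdd_zpow, smul_eq_mul, ← hn, neg_mul, mul_comm, h1, Int.cast_neg, Int.cast_sub,
      Int.cast_mul, Int.cast_natCast, h0, zero_mul, zero_sub, neg_neg]
  have hφker : ∀ x ∈ π.ker, φ x = 1 := by
    intro x hx
    rw [hπ.ker_eq] at hx
    have hle : Subgroup.normalClosure {r} ≤ φ.ker :=
      Subgroup.normalClosure_le_normal (Set.singleton_subset_iff.2 hφr)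
    exact hle hx
  have htriv : ∀ x ∈ π.ker, translation (ZMod k) φ x = 1 := by
    intro x hx
    ext y
    rw [translation_apply, hφker x hx]
    simp
  let a : Γ →* Equiv.Perm (ZMod k) :=
    MonoidHom.liftOfSurjective π hπ.surjective ⟨translation (ZMod k) φ, htriv⟩
  have ha : a.comp π = translation (ZMod k) φ :=
    MonoidHom.liftOfRightInverse_comp _ _ _ ⟨translation (ZMod k) φ, htriv⟩
  have hapi : ∀ g, a (π g) = translation (ZMod k) φ g := fun g => DFunLike.congr_fun ha g
  have htr : ∀ x, ∃ g, a g 0 = x := by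
    intro x
    obtain ⟨b, rfl⟩ := ZMod.intCast_surjective x
    obtain ⟨g, hg⟩ := hsurj b
    exact ⟨π g, by rw [hapi, translation_apply, hg, add_zero]⟩
  let : MulAction Γ (ZMod k) := MulAction.compHom (ZMod k) a
  let N : Subgroup Γ := MulAction.stabilizer Γ (0 : ZMod k)
  have hN : ∀ g, g ∈ N ↔ a g 0 = 0 := fun g => MulAction.mem_stabilizer_iff
  have hNind : N.index = k := by
    have : MulAction.IsPretransitive Γ (ZMod k) := by
      refine ⟨fun x y => ?_⟩
      obtain ⟨g, hg⟩ := htr x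
      obtain ⟨h, hh⟩ := htr y
      refine ⟨h * g⁻¹, ?_⟩
      show a (h * g⁻¹) x = y
      rw [← hg, ← hh, map_mul, map_inv, Equiv.Perm.mul_apply]
      simp
    rw [MulAction.index_stabilizer_of_transitive, Nat.card_zmod]
  have hNfin : N.FiniteIndex := ⟨by rw [hNind]; omega⟩
  refine ⟨k, hBk, N, hNfin, hNind, ?_⟩
  have hdim := (finrank_hom_stabilizer ℚ hπ a N 0 hN htr).2
  rw [ZMod.card] at hdim
  suffices hrank : k - 2 * w ≤ Module.finrank ℚ (LinearMap.range (relatorMap ℚ (a.comp π) r)) + 1 by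
    omega
  obtain ⟨ε, hε, hεof⟩ := exists_crossed (translation (ZMod k) φ)
    (fun j x => FreeGroup.of (j, (x.val : ℤ)))
  let κ : ℤ → FreeGroup (Fin m × ℤ) →* FreeGroup (Fin m × ℤ) := fun b =>
    FreeGroup.lift fun y => FreeGroup.of (y.1, (((b + y.2 : ℤ) : ZMod k).val : ℤ))
  have hκ : ∀ b : ℤ, κ b (δ r 0) = ε r (b : ZMod k) := by
    intro b
    have := crossed_unique (fun i : ℤ => ((b + i : ℤ) : ZMod k))
      (fun g x => by rw [translation_apply, translation_apply]; push_cast; ring) (κ b) hδ hε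
      (fun j x => by rw [hδof, hεof]; simp [κ]) r 0
    rwa [add_zero] at this
  have hεr : ∀ b : ℕ, w ≤ b → b + w < k → ε r (b : ZMod k) = shiftLevel b (δ r 0) := by
    intro b hb hb'
    have h1 := hκ b
    rw [Int.cast_natCast] at h1
    rw [← h1]
    refine hw _ _ fun y hy => ?_
    have hy' := abs_le.1 hy
    obtain ⟨t, ht⟩ := Int.eq_ofNat_of_zero_le (show (0 : ℤ) ≤ b + y.2 by omega)
    have hval : (((b + y.2 : ℤ) : ZMod k).val : ℤ) = b + y.2 := by
      rw [ht, Int.cast_natCast, ZMod.val_natCast_of_lt (by omega)]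
    simp only [κ, FreeGroup.lift_apply_of, hval, shiftLevel, FreeGroup.map.of]
    rw [add_comm]
  have hεker : ∀ x ∈ Subgroup.normalClosure {r}, ∀ i,
      ε x i ∈ unitriangularKernel (FreeGroup (Fin m × ℤ)) c := by
    apply normalClosure_singleton_induction
    · intro i; rw [crossed_one hε]; exact one_mem _
    · intro i
      obtain ⟨b, rfl⟩ := ZMod.intCast_surjective i
      rw [← hκ]
      exact unitriangularKernel_map hρc _
    · intro x _ y _ hx hy i
      rw [hε]
      exact mul_mem (hx _) (hy _)
    · intro x _ hx i
      rw [crossed_inv hε]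
      exact inv_mem (hx _)
    · intro g x hx hx' i
      rw [crossed_conj hε g x (htriv x (by rwa [hπ.ker_eq]))]
      exact unitriangularKernel_conj (hx' _) _
  rw [← hπ.ker_eq] at hεker
  let α : Fin (k - 2 * w) → FreeGroup (Fin m) → ℚ := fun i x =>
    f (cutBelow i₀ (shiftLevel (-((w + i : ℕ) : ℤ)) (ε x 0)))
  have hmem : ∀ x ∈ π.ker, ∀ (d : ℤ) i, cutBelow i₀ (shiftLevel d (ε x i)) ∈
      unitriangularKernel (FreeGroup (Fin m × ℤ)) c := fun x hx d i =>
    unitriangularKernel_map (unitriangularKernel_map (hεker x hx i) _) _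
  have hrker : r ∈ π.ker := by rw [hπ.ker_eq]; exact Subgroup.subset_normalClosure rfl
  have hcard := card_le_finrank_relatorMap hπ a N 0 hN htr (hmel N hNfin) α
    (fun i x hx y hy => by
      show f _ = f _ + f _
      rw [← hfadd _ (hmem x hx _ _) _ (hmem y hy _ _), hε, htriv y hy, map_mul, map_mul]
      rfl)
    (fun i g hg x hx => by
      show f _ = f _
      have hg0 : translation (ZMod k) φ g⁻¹ 0 = 0 := by
        rw [map_inv, Equiv.Perm.inv_eq_iff_eq, ← hapi]
        exact ((hN _).1 hg).symm
      rw [crossed_conj hε g x (htriv x hx), hg0, map_mul, map_mul, map_mul, map_mul, map_inv,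
        map_inv, hfconj _ _ (hmem x hx _ _)])
    (fun v hv => by
      have hval : ∀ (i j : Fin (k - 2 * w)) g,
          (((φ g).toAdd : ℤ) : ZMod k) = ((w + j : ℕ) : ZMod k) →
          α i (g⁻¹ * r * g) = f (cutBelow i₀ (shiftLevel ((j : ℤ) - i) (δ r 0))) := by
        intro i j g hg
        have h1 := crossed_conj hε g⁻¹ r (htriv r hrker) 0
        rw [inv_inv, translation_apply, hg, add_zero, hεr _ (by omega) (by omega)] at h1
        show f _ = f _
        rw [h1, map_mul, map_mul, map_mul, map_mul, map_inv, map_inv, hfconj,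
          shiftLevel_shiftLevel]
        · congr 3
          push_cast
          ring_nf
        · exact unitriangularKernel_map (unitriangularKernel_map
            (unitriangularKernel_map hρc _) _) _
      funext j
      induction j using WellFoundedLT.induction with
      | ind j ih =>
        obtain ⟨g, hg⟩ := hsurj ((w + j : ℕ) : ℤ)
        rw [Int.cast_natCast] at hg
        have h1 := hv g
        rw [Finset.sum_eq_single j] at h1
        · rw [hval j j g hg, sub_self, shiftLevel_zero] at h1
          exact (mul_eq_zero.1 h1).resolve_right hf0
        · intro i _ hij
          rcases lt_or_gt_of_ne hij with h | h
          · rw [ih i h, Pi.zero_apply, zero_mul]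
          · rw [hval i j g hg, cutBelow_shiftLevel, hfvan _ _ _, mul_zero]
            have : (j : ℕ) < i := h
            omega
        · simp)
  rwa [Fintype.card_fin] at hcard

theorem finrank_hom_subgroupOf (K : Type*) [Field K] {Γ : Type*} [Group Γ] {J N : Subgroup Γ}
    (h : J ≤ N) : Module.finrank K (Additive (J.subgroupOf N) →+ K) =
      Module.finrank K (Additive J →+ K) :=
  finrank_hom_congr K (Subgroup.subgroupOfEquivOfLe h)

/-- The number of generators of a finite-index subgroup is at most that predicted by the
Euler characteristic. -/
theorem generators_add_le {Γ : Type*} [Group Γ] {m : ℕ} (hm : 2 ≤ m)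
    {π : FreeGroup (Fin m) →* Γ} {r : FreeGroup (Fin m)} (hπ : IsOneRelatorPresentation π r)
    (hr : r ≠ 1) (hmel : ∀ H : Subgroup Γ, H.FiniteIndex → IsOneRelatorGroup H)
    (N : Subgroup Γ) (hN : N.FiniteIndex) {M : ℕ} {q : FreeGroup (Fin M) →* N}
    {s : FreeGroup (Fin M)} (hq : IsOneRelatorPresentation q s) :
    M + 2 * N.index ≤ m * N.index + 2 := by
  obtain ⟨C, hC⟩ := exists_small_betti hm hπ hr hmel
  obtain ⟨k, hk, L, hL, hLk, hLC⟩ := hC (N.index * C + 1)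
  obtain ⟨mL, qL, sL, hqL⟩ := (hmel L hL).exists_presentation
  have hmL := (finrank_hom_bounds ℚ hqL).2
  have hJ : (N ⊓ L).FiniteIndex := inferInstance
  have b1 := (finrank_hom_subgroup_bounds ℚ hq ((N ⊓ L).subgroupOf N) inferInstance).2
  have b2 := (finrank_hom_subgroup_bounds ℚ hqL ((N ⊓ L).subgroupOf L) inferInstance).1
  rw [finrank_hom_subgroupOf ℚ inf_le_left] at b1
  rw [finrank_hom_subgroupOf ℚ inf_le_right] at b2
  have i1 : ((N ⊓ L).subgroupOf N).index * N.index = (N ⊓ L).index :=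
    Subgroup.relIndex_mul_index inf_le_left
  have i2 : ((N ⊓ L).subgroupOf L).index * L.index = (N ⊓ L).index :=
    Subgroup.relIndex_mul_index inf_le_right
  have hpos : 0 < ((N ⊓ L).subgroupOf L).index := Nat.pos_of_ne_zero Subgroup.FiniteIndex.index_ne_zero
  rw [hLk] at i2
  set e₁ := ((N ⊓ L).subgroupOf N).index
  set e₂ := ((N ⊓ L).subgroupOf L).index
  set e := N.index
  rw [← i2] at i1
  have h1 : M * e₁ + e₂ ≤ 2 * e₁ + mL * e₂ := by omega
  have h2 : M * k + e ≤ 2 * k + mL * e := by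
    refine Nat.le_of_mul_le_mul_left ?_ hpos
    have := Nat.mul_le_mul_right e h1
    calc e₂ * (M * k + e) = M * (e₂ * k) + e₂ * e := by ring
      _ = (M * e₁ + e₂) * e := by rw [← i1]; ring
      _ ≤ (2 * e₁ + mL * e₂) * e := this
      _ = 2 * (e₁ * e) + mL * e₂ * e := by ring
      _ = e₂ * (2 * k + mL * e) := by rw [i1]; ring
  have h3 : mL + 2 * k ≤ m * k + C + 1 := by omega
  by_contra hcon
  have h4 : m * e + 3 ≤ M + 2 * e := by omega
  have h5 := Nat.mul_le_mul_right k h4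
  have h6 := Nat.mul_le_mul_right e h3
  nlinarith

/-- The relator map of a finite quotient has corank at most one. -/
theorem index_le_finrank_relatorMap (K : Type*) [Field K] {Γ : Type*} [Group Γ] {m : ℕ}
    (hm : 2 ≤ m) {π : FreeGroup (Fin m) →* Γ} {r : FreeGroup (Fin m)}
    (hπ : IsOneRelatorPresentation π r) (hr : r ≠ 1)
    (hmel : ∀ H : Subgroup Γ, H.FiniteIndex → IsOneRelatorGroup H)
    (N : Subgroup Γ) (hN : N.FiniteIndex) :
    N.index ≤ Module.finrank K (LinearMap.range
        (relatorMap K ((MulAction.toPermHom Γ (Γ ⧸ N)).comp π) r)) + 1 := by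
  obtain ⟨M, q, s, hq⟩ := (hmel N hN).exists_presentation
  have h1 := generators_add_le hm hπ hr hmel N hN hq
  have h2 := (finrank_hom_bounds K hq).1
  have h3 := (finrank_hom_subgroup K hπ N hN).2
  omega

section Pushforward

variable {K : Type*} [Field K] {G X Y : Type*} [Group G] {a : G →* Equiv.Perm X}
  {b : G →* Equiv.Perm Y}

theorem actionCocycles_comap {δ : G → Y → K} (hδ : δ ∈ actionCocycles K b) (T : X → Y)
    (hT : ∀ g x, T (a g x) = b g (T x)) : (fun g x => δ g (T x)) ∈ actionCocycles K a := by
  intro g h x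
  simp only [hT]
  exact hδ g h (T x)

theorem actionCocycles_pushforward [Fintype X] [DecidableEq Y] {δ : G → X → K}
    (hδ : δ ∈ actionCocycles K a) (T : X → Y) (hT : ∀ g x, T (a g x) = b g (T x)) :
    (fun g y => ∑ x, if T x = y then δ g x else 0) ∈ actionCocycles K b := by
  intro g h y
  show (∑ x, if T x = y then δ (g * h) x else 0) =
    (∑ x, if T x = b h y then δ g x else 0) + ∑ x, if T x = y then δ h x else 0
  rw [← Equiv.sum_comp (a h) fun x => if T x = b h y then δ g x else 0,
    ← Finset.sum_add_distrib]
  refine Finset.sum_congr rfl fun x _ => ?_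
  rw [hT, hδ]
  simp only [(b h).injective.eq_iff]
  split_ifs <;> simp

end Pushforward

/-- Two functionals vanishing on a subspace of corank at most one are proportional. -/
theorem functionals_proportional {K V : Type*} [Field K] [AddCommGroup V] [Module K V]
    [FiniteDimensional K V] {W : Submodule K V}
    (hW : Module.finrank K V ≤ Module.finrank K W + 1) (A B : Module.Dual K V)
    (hA : ∀ x ∈ W, A x = 0) (hB : ∀ x ∈ W, B x = 0) (x y : V) : A x * B y = A y * B x := by
  have h1 := Submodule.finrank_quotient_add_finrank W
  have h2 : Module.finrank K (V ⧸ W) ≤ 1 := by omega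
  obtain ⟨v, hv⟩ := finrank_le_one_iff.1 h2
  obtain ⟨s, hs⟩ := hv (W.mkQ x)
  obtain ⟨t, ht⟩ := hv (W.mkQ y)
  have key : ∀ C : Module.Dual K V, (∀ x ∈ W, C x = 0) →
      ∃ u, C x = s * u ∧ C y = t * u := by
    intro C hC
    have hC' : W ≤ LinearMap.ker C := hC
    have hlift : ∀ z, W.liftQ C hC' (W.mkQ z) = C z := fun z => W.liftQ_apply C z
    refine ⟨W.liftQ C hC' v, ?_, ?_⟩
    · rw [← smul_eq_mul, ← map_smul, hs, hlift]
    · rw [← smul_eq_mul, ← map_smul, ht, hlift]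
  obtain ⟨u, hu, hu'⟩ := key A hA
  obtain ⟨u', hu1, hu2⟩ := key B hB
  rw [hu, hu', hu1, hu2]
  ring

/-- If the index of `H` vanishes in `K`, some cocycle for the action on the cosets of `H` takes
the constant value one on the relator. -/
theorem exists_cocycle_relator_one (K : Type*) [Field K] {Γ : Type*} [Group Γ] {m : ℕ}
    (hm : 2 ≤ m) {π : FreeGroup (Fin m) →* Γ} {r : FreeGroup (Fin m)}
    (hπ : IsOneRelatorPresentation π r) (hr : r ≠ 1)
    (hmel : ∀ H : Subgroup Γ, H.FiniteIndex → IsOneRelatorGroup H)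
    (H : Subgroup Γ) (hH : H.FiniteIndex) (hK : (H.index : K) = 0) :
    ∃ δ ∈ actionCocycles K ((MulAction.toPermHom Γ (Γ ⧸ H)).comp π), ∀ x, δ r x = 1 := by
  classical
  have : Fintype (Γ ⧸ H) := H.fintypeQuotientOfFiniteIndex
  have : Fintype (Γ ⧸ H.normalCore) := H.normalCore.fintypeQuotientOfFiniteIndex
  set W := LinearMap.range (relatorMap K ((MulAction.toPermHom Γ (Γ ⧸ H)).comp π) r) with hW
  suffices hmem : (fun _ => 1 : Γ ⧸ H → K) ∈ W by
    obtain ⟨δ, hδ⟩ := hmem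
    exact ⟨δ.1, δ.2, congrFun hδ⟩
  by_contra hcon
  obtain ⟨l, hl1, hlW⟩ := Submodule.exists_le_ker_of_notMem hcon
  let c : Γ ⧸ H → K := fun y => l (Pi.single y 1)
  have hl : ∀ f, l f = ∑ y, f y * c y := by
    intro f
    rw [LinearMap.pi_apply_eq_sum_univ l f]
    refine Finset.sum_congr rfl fun x _ => ?_
    have h1 : (fun j => if x = j then (1 : K) else 0) = Pi.single x 1 := by
      funext j
      simp [Pi.single_apply, eq_comm]
    rw [h1, smul_eq_mul]
  let p : Γ ⧸ H.normalCore → Γ ⧸ H := Subgroup.quotientMapOfLE H.normalCore_le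
  have hkill : ∀ δ ∈ actionCocycles K ((MulAction.toPermHom Γ (Γ ⧸ H.normalCore)).comp π),
      ∑ x, δ r x * c (p x) = 0 := by
    intro δ hδ
    have h1 := actionCocycles_pushforward (b := (MulAction.toPermHom Γ (Γ ⧸ H)).comp π) hδ p
      (fun g x => by
        obtain ⟨x, rfl⟩ := QuotientGroup.mk_surjective x
        rfl)
    have h2 : l (fun y => ∑ x, if p x = y then δ r x else 0) = 0 := hlW ⟨⟨_, h1⟩, rfl⟩
    rw [hl] at h2
    simp only [Finset.sum_mul] at h2
    rw [Finset.sum_comm] at h2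
    simpa using h2
  let D : Γ → Module.Dual K (Γ ⧸ H.normalCore → K) := fun z =>
    { toFun := fun f => ∑ x, f x * c (p (x * (z : Γ ⧸ H.normalCore)))
      map_add' := fun f f' => by simp [add_mul, Finset.sum_add_distrib]
      map_smul' := fun t f => by simp [Finset.mul_sum, mul_assoc] }
  have hD : ∀ z, ∀ f ∈ LinearMap.range (relatorMap K
      ((MulAction.toPermHom Γ (Γ ⧸ H.normalCore)).comp π) r), D z f = 0 := by
    rintro z _ ⟨δ, rfl⟩
    have h1 := hkill _ (actionCocycles_comap δ.2 (fun x => x * (z : Γ ⧸ H.normalCore)⁻¹)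
      (fun g x => by
        obtain ⟨x, rfl⟩ := QuotientGroup.mk_surjective x
        exact congrArg _ (mul_assoc (π g) x z⁻¹)))
    rw [← h1, ← Equiv.sum_comp (Equiv.mulRight (z : Γ ⧸ H.normalCore))]
    refine Finset.sum_congr rfl fun x _ => ?_
    simp [relatorMap]
  have hcork : Module.finrank K (Γ ⧸ H.normalCore → K) ≤ Module.finrank K (LinearMap.range
      (relatorMap K ((MulAction.toPermHom Γ (Γ ⧸ H.normalCore)).comp π) r)) + 1 := by
    have := index_le_finrank_relatorMap K hm hπ hr hmel H.normalCore inferInstance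
    rwa [Module.finrank_fintype_fun_eq_card, ← Nat.card_eq_fintype_card,
      ← Subgroup.index_eq_card]
  have hmul : ∀ g z : Γ, c (g : Γ ⧸ H) * c (z : Γ ⧸ H) = c (1 : Γ) * c ((g * z : Γ) : Γ ⧸ H) := by
    intro g z
    have h1 := functionals_proportional hcork (D 1) (D z) (hD 1) (hD z)
      (Pi.single ((g : Γ) : Γ ⧸ H.normalCore) 1) (Pi.single ((1 : Γ) : Γ ⧸ H.normalCore) 1)
    have hsingle : ∀ (z : Γ) (x : Γ ⧸ H.normalCore),
        D z (Pi.single x 1) = c (p (x * (z : Γ ⧸ H.normalCore))) := by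
      intro z x
      show ∑ y, (Pi.single x 1 : Γ ⧸ H.normalCore → K) y *
        c (p (y * (z : Γ ⧸ H.normalCore))) = _
      simp [Pi.single_apply]
    rw [hsingle, hsingle, hsingle, hsingle, ← QuotientGroup.mk_mul, ← QuotientGroup.mk_mul,
      ← QuotientGroup.mk_mul, ← QuotientGroup.mk_mul, mul_one, mul_one, one_mul] at h1
    exact h1
  have hS : l (fun _ => 1) = ∑ y, c y := by rw [hl]; simp
  have hconst : ∀ g : Γ, c (g : Γ ⧸ H) = c (1 : Γ) := by
    intro g
    have h1 : c (g : Γ ⧸ H) * ∑ y, c y = c (1 : Γ) * ∑ y, c y := by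
      conv_rhs => rw [← Equiv.sum_comp (MulAction.toPerm g : Equiv.Perm (Γ ⧸ H)) c]
      rw [Finset.mul_sum, Finset.mul_sum]
      refine Finset.sum_congr rfl fun y _ => ?_
      obtain ⟨y, rfl⟩ := QuotientGroup.mk_surjective y
      exact hmul g y
    rw [← hS] at h1
    exact mul_right_cancel₀ hl1 h1
  apply hl1
  rw [hS, Finset.sum_congr rfl (g := fun _ => c (1 : Γ))]
  · rw [Finset.sum_const, Finset.card_univ, nsmul_eq_mul, ← Nat.card_eq_fintype_card,
      ← Subgroup.index_eq_card, hK, zero_mul]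
  · intro y _
    obtain ⟨y, rfl⟩ := QuotientGroup.mk_surjective y
    exact hconst y

/-- A two-cocycle with trivial coefficients becomes a coboundary on a free group. -/
theorem exists_primitive_of_cocycle {K ι Γ : Type*} [AddCommGroup K] [Group Γ]
    (π : FreeGroup ι →* Γ) (f : Γ × Γ → K)
    (hf : ∀ g h j, f (g * h, j) + f (g, h) = f (h, j) + f (g, h * j)) :
    ∃ B : FreeGroup ι → K, ∀ x y, B (x * y) = B x + B y - f (π x, π y) := by
  have hone : ∀ x, f (1, x) = f (1, 1) := by
    intro x
    have := hf 1 1 x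
    simpa using this.symm
  obtain ⟨δ, hδ, hof⟩ := exists_crossed ((MulAction.toPermHom Γ Γ).comp π)
    (fun i x => Multiplicative.ofAdd (-f (π (FreeGroup.of i), x)))
  let D : FreeGroup ι → Γ → K := fun g x => (δ g x).toAdd + f (π g, x)
  have hD : ∀ g h x, D (g * h) x = D g (π h * x) + D h x - f (π g, π h) := by
    intro g h x
    have h1 : (δ (g * h) x).toAdd = (δ g (π h * x)).toAdd + (δ h x).toAdd := by
      rw [hδ]; rfl
    have h2 := hf (π g) (π h) x
    simp only [D, h1, map_mul]
    rw [eq_sub_iff_add_eq, add_assoc, h2]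
    abel
  have hD1 : ∀ x, D 1 x = f (1, 1) := by
    intro x
    simp only [D, crossed_one hδ, map_one, toAdd_one, zero_add, hone]
  have hconst : ∀ g x, D g x = D g 1 := by
    intro g
    induction g using FreeGroup.induction_on with
    | C1 => intro x; rw [hD1, hD1]
    | of i =>
      have : ∀ x, D (FreeGroup.of i) x = 0 := fun x => by simp [D, hof]
      intro x; rw [this, this]
    | inv_of i ih =>
      have key : ∀ x, D (FreeGroup.of i)⁻¹ x =
          f (1, 1) + f (π (FreeGroup.of i), π (FreeGroup.of i)⁻¹) - D (FreeGroup.of i) 1 := by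
        intro x
        have := hD (FreeGroup.of i) (FreeGroup.of i)⁻¹ x
        rw [mul_inv_cancel, hD1, ih] at this
        rw [this]
        abel
      intro x; rw [key, key]
    | mul g h hg hh => intro x; rw [hD, hD, hg, hh, hg (π h * 1)]
  refine ⟨fun g => D g 1, fun x y => ?_⟩
  show D (x * y) 1 = _
  rw [hD, hconst x]

/-- If the index of `H` vanishes in `K`, every two-cocycle becomes a coboundary on `H`. -/
theorem exists_trivialization (K : Type*) [Field K] {Γ : Type*} [Group Γ] {m : ℕ}
    (hm : 2 ≤ m) {π : FreeGroup (Fin m) →* Γ} {r : FreeGroup (Fin m)}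
    (hπ : IsOneRelatorPresentation π r)
    (hmel : ∀ H : Subgroup Γ, H.FiniteIndex → IsOneRelatorGroup H)
    (H : Subgroup Γ) (hH : H.FiniteIndex) (hK : (H.index : K) = 0) (f : Γ × Γ → K)
    (hf : ∀ g h j, f (g * h, j) + f (g, h) = f (h, j) + f (g, h * j)) :
    ∃ γ : Γ → K, ∀ g, ∀ h ∈ H, γ h - γ (g * h) + γ g = f (g, h) := by
  obtain ⟨B, hB⟩ := exists_primitive_of_cocycle π f hf
  have hone : ∀ x, f (1, x) = f (1, 1) := by
    intro x
    have := hf 1 1 x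
    simpa using this.symm
  have hone' : ∀ x, f (x, 1) = f (1, 1) := by
    intro x
    have := hf x 1 1
    simpa using this
  set c := f (1, 1) with hc
  have hB1 : B 1 = c := by
    have := hB 1 1
    rw [mul_one, map_one] at this
    linear_combination -this
  have hker : ∀ x ∈ Subgroup.normalClosure {r}, π x = 1 := by
    intro x hx
    rwa [← hπ.ker_eq] at hx
  set a := (MulAction.toPermHom Γ (Γ ⧸ H)).comp π with ha
  have hkera : ∀ x ∈ Subgroup.normalClosure {r}, a x = 1 := by
    intro x hx
    rw [ha, MonoidHom.comp_apply, hker x hx, map_one]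
  obtain ⟨δ, hδ, hδr⟩ : ∃ δ ∈ actionCocycles K a, ∀ y, δ r y = B r - c := by
    by_cases hr : r = 1
    · exact ⟨0, Submodule.zero_mem _, fun y => by simp [hr, hB1]⟩
    · obtain ⟨δ, hδ, h1⟩ := exists_cocycle_relator_one K hm hπ hr hmel H hH hK
      exact ⟨(B r - c) • δ, Submodule.smul_mem _ _ hδ, fun y => by simp [h1]⟩
  have hR : ∀ x ∈ Subgroup.normalClosure {r}, ∀ y, δ x y = B x - c := by
    refine normalClosure_singleton_induction ?_ hδr ?_ ?_ ?_
    · intro y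
      rw [actionCocycles_one hδ, hB1, sub_self]
    · intro x hx x' hx' h h' y
      rw [hδ, h, h', hB, hker x hx, hker x' hx', ← hc]
      ring
    · intro x hx h y
      have := hB x x⁻¹
      rw [mul_inv_cancel, hB1, map_inv, hker x hx, inv_one, ← hc] at this
      rw [actionCocycles_inv hδ, h]
      linear_combination this
    · intro g x hx h y
      have h1 := hB g x
      have h2 := hB (g * x * g⁻¹) g
      rw [inv_mul_cancel_right, map_mul, map_mul, hker x hx, mul_one, map_inv, mul_inv_cancel,
        hone] at h2
      rw [hker x hx, hone'] at h1
      rw [actionCocycles_conj hδ _ _ (hkera x hx), h]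
      linear_combination h2 - h1
  let o : Γ ⧸ H := ((1 : Γ) : Γ ⧸ H)
  obtain ⟨s, hs⟩ := hπ.surjective.hasRightInverse
  let γ : Γ → K := fun g => B (s g) - δ (s g) o
  have hγ : ∀ x, γ (π x) = B x - δ x o := by
    intro x
    have hk : (s (π x))⁻¹ * x ∈ Subgroup.normalClosure {r} := by
      rw [← hπ.ker_eq, MonoidHom.mem_ker, map_mul, map_inv, hs, inv_mul_cancel]
    have h1 := hB (s (π x)) ((s (π x))⁻¹ * x)
    have h2 := hδ (s (π x)) ((s (π x))⁻¹ * x) o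
    rw [hkera _ hk, hR _ hk, mul_inv_cancel_left, Equiv.Perm.one_apply] at h2
    rw [mul_inv_cancel_left, hker _ hk, hone'] at h1
    show B (s (π x)) - δ (s (π x)) o = _
    linear_combination h2 - h1
  refine ⟨γ, fun g h hh => ?_⟩
  obtain ⟨x, rfl⟩ := hπ.surjective g
  obtain ⟨y, rfl⟩ := hπ.surjective h
  have h1 := hδ x y o
  have h2 : a y o = o := (mem_iff_toPermHom H (π y)).1 hh
  rw [h2] at h1
  rw [← map_mul, hγ, hγ, hγ, hB, h1]
  ring

section Restriction

open CategoryTheory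

variable (p : ℕ) {H G : Type} [Group H] [Group G]

/-- Pulling back trivial coefficients gives trivial coefficients. -/
noncomputable def resTrivialHom (φ : H →* G) :
    Rep.res φ (Rep.trivial (ZMod p) G (ZMod p)) ⟶ Rep.trivial (ZMod p) H (ZMod p) :=
  𝟙 (Rep.trivial (ZMod p) H (ZMod p))

theorem cohomologyRestriction_eq_map (φ : H →* G) (i : ℕ) :
    cohomologyRestriction p φ i = groupCohomology.map φ (resTrivialHom p φ) i := by
  have h : resChainMap p φ = groupCohomology.cochainsMap φ (resTrivialHom p φ) := rfl
  unfold cohomologyRestriction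
  rw [h]

/-- Degree-two restriction vanishes if every two-cocycle becomes a coboundary. -/
theorem cohomologyRestriction_two_eq_zero (φ : H →* G)
    (h : ∀ f : G × G → ZMod p,
      (∀ g h j, f (g * h, j) + f (g, h) = f (h, j) + f (g, h * j)) →
      ∃ γ : H → ZMod p, ∀ g h, γ h - γ (g * h) + γ g = f (φ g, φ h)) :
    cohomologyRestriction p φ 2 = 0 := by
  rw [cohomologyRestriction_eq_map]
  rw [← cancel_epi (groupCohomology.H2π (Rep.trivial (ZMod p) G (ZMod p))),
    groupCohomology.H2π_comp_map, Limits.comp_zero]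
  refine ModuleCat.hom_ext (LinearMap.ext fun x => ?_)
  show groupCohomology.H2π (Rep.trivial (ZMod p) H (ZMod p))
    (groupCohomology.mapCocycles₂ φ (resTrivialHom p φ) x) = 0
  rw [groupCohomology.H2π_eq_zero_iff]
  obtain ⟨γ, hγ⟩ := h x.1 fun g h j => by
    have := (groupCohomology.mem_cocycles₂_iff
      (A := Rep.trivial (ZMod p) G (ZMod p)) x.1).1 x.2 g h j
    exact this
  refine ⟨γ, funext fun ⟨g, h⟩ => ?_⟩
  exact hγ g h

end Restriction

/-- The quotient of a free group by one relator is presented by that relator. -/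
theorem isOneRelatorPresentation_quotient {n : ℕ} (w : FreeGroup (Fin n)) :
    IsOneRelatorPresentation (QuotientGroup.mk' (Subgroup.normalClosure {w})) w :=
  ⟨QuotientGroup.mk'_surjective _, QuotientGroup.ker_mk' (Subgroup.normalClosure {w})⟩

/-- If all finite-index subgroups of `G` are one-relator groups, the same holds for its
finite-index subgroups. -/
theorem isOneRelatorGroup_of_le {G : Type*} [Group G]
    (hmel : ∀ H : Subgroup G, H.FiniteIndex → IsOneRelatorGroup H)
    (U : Subgroup G) (hU : U.FiniteIndex) (H : Subgroup U) (hH : H.FiniteIndex) :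
    IsOneRelatorGroup H := by
  refine .of_mulEquiv (H.equivMapOfInjective U.subtype U.subtype_injective) (hmel _ ⟨?_⟩)
  have h : (H.map U.subtype).subgroupOf U = H := by
    exact Subgroup.comap_map_eq_self_of_injective U.subtype_injective H
  rw [← Subgroup.relIndex_mul_index (Subgroup.map_subtype_le H), Subgroup.relIndex, h]
  exact mul_ne_zero hH.index_ne_zero hU.index_ne_zero
/-- For a residually finite Mel'nikov one-relator group `G` on `n ≥ 3` generators (with
relator `w` nontrivial, not primitive and not a proper power): if `U₁ ≤ U₂` are finite-index
subgroups of `G` with `p ∣ [U₂ : U₁]`, then the restriction map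
`H²(U₂; 𝔽_p) → H²(U₁; 𝔽_p)` is zero. -/
theorem stmt14 (n : ℕ) (hn : 3 ≤ n) (w : FreeGroup (Fin n)) (hw1 : w ≠ 1)
    (hwnotprim : ¬ ∃ (ι : Type) (b : FreeGroupBasis ι (FreeGroup (Fin n))) (i : ι), b i = w)
    (hwnotpow : ¬ ∃ (v : FreeGroup (Fin n)) (r : ℕ), 2 ≤ r ∧ w = v ^ r)
    (hres : ResiduallyFinite (FreeGroup (Fin n) ⧸ Subgroup.normalClosure {w}))
    (hmel : ∀ H : Subgroup (FreeGroup (Fin n) ⧸ Subgroup.normalClosure {w}),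
      H.FiniteIndex → IsOneRelatorGroup H)
    (p : ℕ) (hp : p.Prime)
    (U₁ U₂ : Subgroup (FreeGroup (Fin n) ⧸ Subgroup.normalClosure {w}))
    (h12 : U₁ ≤ U₂) (hU1 : U₁.FiniteIndex) (hU2 : U₂.FiniteIndex)
    (hdvd : p ∣ U₁.relIndex U₂) :
    cohomologyRestriction p (Subgroup.inclusion h12) 2 = 0 := by

  have : Fact p.Prime := ⟨hp⟩
  obtain ⟨m, π, r, hπ⟩ := (hmel U₂ hU2).exists_presentation
  have hm : 2 ≤ m := by
    have h1 := (finrank_hom_subgroup_bounds ℚ (isOneRelatorPresentation_quotient w) U₂ hU2).2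
    have h2 := (finrank_hom_bounds ℚ hπ).1
    have h3 : 0 < U₂.index := Nat.pos_of_ne_zero hU2.index_ne_zero
    have h4 := Nat.mul_le_mul_right U₂.index hn
    omega
  have hU : (U₁.subgroupOf U₂).FiniteIndex := inferInstance
  have hK : ((U₁.subgroupOf U₂).index : ZMod p) = 0 := (ZMod.natCast_eq_zero_iff _ _).2 hdvd
  refine cohomologyRestriction_two_eq_zero p _ fun f hf => ?_
  obtain ⟨γ, hγ⟩ := exists_trivialization (ZMod p) hm hπ
    (isOneRelatorGroup_of_le hmel U₂ hU2) (U₁.subgroupOf U₂) hU hK f hf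
  refine ⟨fun u => γ (Subgroup.inclusion h12 u), fun g h => ?_⟩
  show _ - γ (Subgroup.inclusion h12 (g * h)) + _ = _
  rw [map_mul]
  exact hγ _ _ h.2
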